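/- arXiv:1309.5892 — 3 statements merged into one kernel-verified Lean document; each statement's English description precedes it below -/
import Mathlib

section
/- Let s ∈ (0,1/2), let n ≥ 1, let ν : ℝⁿ → ℝⁿ be smooth with bounded derivatives of all orders, and let φ : ℝⁿ → [0,1] be a smooth function with φ(ξ) = 0 for |ξ| < 1 and φ(ξ) = 1 for |ξ| > 2. Define ã(x,ξ) = |ξ|^{2s} φ(2ξ) + i ν(x)·ξ and q₁(x,ξ) = φ(ξ)/ã(x,ξ); q₁ is well defined and smooth because |ã(x,ξ)| ≥ |ξ|^{2s} ≥ 1 whenever φ(ξ) ≠ 0. Then q₁ belongs to the Hörmander class S^{−2s}_{2s,1−2s}: for all multi-indices α, β ∈ ℕⁿ there exists a constant C_{α,β} such that |∂_x^α ∂_ξ^β q₁(x,ξ)| ≤ C_{α,β} (1+|ξ|)^{−2s − 2s|β| + (1−2s)|α|} for all x, ξ ∈ ℝⁿ. -/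
open scoped RealInnerProductSpace

/-- The smoothed symbol `ã(x,ξ) = |ξ|^{2s} φ(2ξ) + i ν(x)·ξ` of the fractional
Laplacian with drift. -/
noncomputable def smoothedSymbol {n : ℕ} (s : ℝ)
    (ν : EuclideanSpace ℝ (Fin n) → EuclideanSpace ℝ (Fin n))
    (φ : EuclideanSpace ℝ (Fin n) → ℝ) (x ξ : EuclideanSpace ℝ (Fin n)) : ℂ :=
  ((‖ξ‖ ^ (2 * s) * φ ((2 : ℝ) • ξ) : ℝ) : ℂ) + Complex.I * ((⟪ν x, ξ⟫ : ℝ) : ℂ)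

/-- The first parametrix approximation `q₁(x,ξ) = φ(ξ)/ã(x,ξ)`. -/
noncomputable def parametrixSymbol {n : ℕ} (s : ℝ)
    (ν : EuclideanSpace ℝ (Fin n) → EuclideanSpace ℝ (Fin n))
    (φ : EuclideanSpace ℝ (Fin n) → ℝ) (x ξ : EuclideanSpace ℝ (Fin n)) : ℂ :=
  ((φ ξ : ℝ) : ℂ) / smoothedSymbol s ν φ x ξ

section helpers

open scoped ContDiff

lemma aux_comp_affine {G E V : Type*} [NormedAddCommGroup G] [NormedSpace ℝ G]
    [NormedAddCommGroup E] [NormedSpace ℝ E] [NormedAddCommGroup V] [NormedSpace ℝ V]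
    {f : E → V} (hf : ContDiff ℝ (⊤ : ℕ∞) f) (A : G →L[ℝ] E) (c : E) (i : ℕ) (x : G) :
    iteratedFDeriv ℝ i (fun y => f (A y + c)) x =
      (iteratedFDeriv ℝ i f (A x + c)).compContinuousLinearMap (fun _ => A) := by
  have h1 : ContDiff ℝ (⊤ : ℕ∞) (fun z => f (z + c)) := hf.comp (contDiff_id.add contDiff_const)
  have h2 := A.iteratedFDeriv_comp_right h1 x (i := i) (by exact_mod_cast le_top)
  rw [iteratedFDeriv_comp_add_right] at h2
  exact h2

lemma aux_comp_affine_norm {G E V : Type*} [NormedAddCommGroup G] [NormedSpace ℝ G]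
    [NormedAddCommGroup E] [NormedSpace ℝ E] [NormedAddCommGroup V] [NormedSpace ℝ V]
    {f : E → V} (hf : ContDiff ℝ (⊤ : ℕ∞) f) (A : G →L[ℝ] E) (c : E) (i : ℕ) (x : G) :
    ‖iteratedFDeriv ℝ i (fun y => f (A y + c)) x‖ ≤
      ‖iteratedFDeriv ℝ i f (A x + c)‖ * ‖A‖ ^ i := by
  rw [aux_comp_affine hf]
  refine (ContinuousMultilinearMap.norm_compContinuousLinearMap_le _ _).trans ?_
  simp

lemma aux_li {E V W : Type*}
    [NormedAddCommGroup E] [NormedSpace ℝ E] [NormedAddCommGroup V] [NormedSpace ℝ V]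
    [NormedAddCommGroup W] [NormedSpace ℝ W]
    (f : E → V) (h : E → W) (g : V ≃ₗᵢ[ℝ] W) (hh : ∀ x, h x = g (f x)) (m : ℕ) (x : E) :
    ‖iteratedFDeriv ℝ m h x‖ = ‖iteratedFDeriv ℝ m f x‖ := by
  have : h = g ∘ f := funext hh
  rw [this, LinearIsometryEquiv.norm_iteratedFDeriv_comp_left]

lemma aux_iter_iter {E V : Type*}
    [NormedAddCommGroup E] [NormedSpace ℝ E] [NormedAddCommGroup V] [NormedSpace ℝ V]
    (f : E → V) (k : ℕ) : ∀ (m : ℕ) (x : E),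
    ‖iteratedFDeriv ℝ m (iteratedFDeriv ℝ k f) x‖ = ‖iteratedFDeriv ℝ (k + m) f x‖ := by
  induction k with
  | zero =>
    intro m x
    rw [iteratedFDeriv_zero_eq_comp, LinearIsometryEquiv.norm_iteratedFDeriv_comp_left, zero_add]
  | succ k ih =>
    intro m x
    have := aux_li (fderiv ℝ (iteratedFDeriv ℝ k f)) (iteratedFDeriv ℝ (k + 1) f)
      (continuousMultilinearCurryLeftEquiv ℝ (fun _ : Fin (k + 1) => E) V).symm
      (fun x => rfl) m x
    rw [this, norm_iteratedFDeriv_fderiv, ih, show k + 1 + m = k + (m + 1) by omega]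

lemma aux_mixed {E P V : Type*} [NormedAddCommGroup P] [NormedSpace ℝ P]
    [NormedAddCommGroup E] [NormedSpace ℝ E] [NormedAddCommGroup V] [NormedSpace ℝ V]
    {F : P → V} (hF : ContDiff ℝ (⊤ : ℕ∞) F) (A B : E →L[ℝ] P) (c : P) (k m : ℕ) (x ξ : E) :
    ‖iteratedFDeriv ℝ m
      (fun ξ' => iteratedFDeriv ℝ k (fun x' => F (A x' + (B ξ' + c))) x) ξ‖ ≤
      ‖A‖ ^ k * (‖iteratedFDeriv ℝ (k + m) F (A x + (B ξ + c))‖ * ‖B‖ ^ m) := by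
  have h1 : (fun ξ' => iteratedFDeriv ℝ k (fun x' => F (A x' + (B ξ' + c))) x) =
      (ContinuousMultilinearMap.compContinuousLinearMapL (F := V) (fun _ : Fin k => A)) ∘
        (fun ξ' => iteratedFDeriv ℝ k F (B ξ' + (A x + c))) := by
    funext ξ'
    rw [aux_comp_affine hF A (B ξ' + c)]
    simp only [Function.comp]
    rw [show A x + (B ξ' + c) = B ξ' + (A x + c) by abel]
    rfl
  have hk : ContDiff ℝ (⊤ : ℕ∞) (iteratedFDeriv ℝ k F) := by
    apply hF.iteratedFDeriv_right
    exact_mod_cast le_top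
  have h2 : ContDiff ℝ (⊤ : ℕ∞) (fun ξ' => iteratedFDeriv ℝ k F (B ξ' + (A x + c))) :=
    hk.comp (B.contDiff.add contDiff_const)
  rw [h1]
  refine (ContinuousLinearMap.norm_iteratedFDeriv_comp_left _ h2.contDiffAt
    (by exact_mod_cast le_top)).trans ?_
  gcongr
  · exact (ContinuousMultilinearMap.norm_compContinuousLinearMapL_le _ _).trans (by simp)
  · refine (aux_comp_affine_norm hk B (A x + c) m ξ).trans ?_
    rw [aux_iter_iter, show B ξ + (A x + c) = A x + (B ξ + c) by abel]

lemma aux_homog {E V : Type*} [NormedAddCommGroup E] [NormedSpace ℝ E] [FiniteDimensional ℝ E]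
    [NormedAddCommGroup V] [NormedSpace ℝ V] (f : E → V) (r : ℝ)
    (hf : ∀ x, x ≠ 0 → ContDiffAt ℝ (⊤ : ℕ∞) f x)
    (hh : ∀ t : ℝ, 0 < t → ∀ x, f (t • x) = t ^ r • f x) (j : ℕ) :
    ∃ C : ℝ, 0 ≤ C ∧ ∀ x, x ≠ 0 → ‖iteratedFDeriv ℝ j f x‖ ≤ C * ‖x‖ ^ (r - j) := by
  have : ProperSpace E := FiniteDimensional.proper ℝ E
  have hcont : ContinuousOn (iteratedFDeriv ℝ j f) (Metric.sphere 0 1) := by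
    intro x hx
    have hx0 : x ≠ 0 := by rintro rfl; simp at hx
    have := (hf x hx0).iteratedFDeriv_right (m := 0) (i := j) (by
      rw [zero_add]; exact_mod_cast le_top)
    exact this.continuousAt.continuousWithinAt
  obtain ⟨C, hC⟩ := (isCompact_sphere (0 : E) 1).exists_bound_of_continuousOn hcont
  refine ⟨max C 0, le_max_right _ _, fun x hx => ?_⟩
  have hxn : 0 < ‖x‖ := norm_pos_iff.2 hx
  set t : ℝ := ‖x‖⁻¹ with ht
  have ht0 : 0 < t := inv_pos.2 hxn
  have hy : t • x ∈ Metric.sphere (0 : E) 1 := by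
    simp [norm_smul, ht, hxn.ne']
  have hfe : (fun y => f (t • y)) = t ^ r • f := by
    funext y; exact hh t ht0 y
  let e : E ≃L[ℝ] E := ContinuousLinearEquiv.smulLeft (Units.mk0 t ht0.ne')
  have he : ∀ y, e y = t • y := fun y => rfl
  have h1 : iteratedFDeriv ℝ j (f ∘ e) x =
      (iteratedFDeriv ℝ j f (e x)).compContinuousLinearMap (fun _ => (e : E →L[ℝ] E)) := by
    have := e.iteratedFDerivWithin_comp_right (𝕜 := ℝ) f uniqueDiffOn_univ
      (x := x) (Set.mem_univ _) j
    simpa [iteratedFDerivWithin_univ] using this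
  have h2 : iteratedFDeriv ℝ j (f ∘ e) x = t ^ r • iteratedFDeriv ℝ j f x := by
    have : f ∘ e = t ^ r • f := hfe
    rw [this]
    exact iteratedFDeriv_const_smul_apply ((hf x hx).of_le (by exact_mod_cast le_top))
  have hen : ‖(e : E →L[ℝ] E)‖ ≤ t := by
    refine ContinuousLinearMap.opNorm_le_bound _ ht0.le fun y => ?_
    simp [he, norm_smul, abs_of_pos ht0]
  have h3 : t ^ r * ‖iteratedFDeriv ℝ j f x‖ ≤ max C 0 * t ^ j := by
    have : ‖t ^ r • iteratedFDeriv ℝ j f x‖ = t ^ r * ‖iteratedFDeriv ℝ j f x‖ := by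
      rw [norm_smul, Real.norm_of_nonneg (Real.rpow_nonneg ht0.le _)]
    rw [← this, ← h2, h1]
    refine (ContinuousMultilinearMap.norm_compContinuousLinearMap_le _ _).trans ?_
    simp only [Finset.prod_const, Finset.card_univ, Fintype.card_fin]
    gcongr
    exact (hC _ hy).trans (le_max_left _ _)
  have htr : 0 < t ^ r := Real.rpow_pos_of_pos ht0 _
  have h4 : ‖iteratedFDeriv ℝ j f x‖ ≤ max C 0 * t ^ j / t ^ r := by
    rw [le_div_iff₀ htr]; linarith
  refine h4.trans (le_of_eq ?_)
  rw [mul_div_assoc]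
  congr 1
  rw [ht, Real.inv_rpow hxn.le, Real.rpow_sub hxn, Real.rpow_natCast, inv_pow]
  field_simp

lemma aux_inv_bound (c : ℝ) (hc : 0 < c) (N : ℕ) :
    ∃ C : ℝ, 0 ≤ C ∧ ∀ i ≤ N, ∀ z : ℂ, c ≤ ‖z‖ →
      ‖iteratedFDeriv ℝ i (fun z : ℂ => z⁻¹) z‖ ≤ C := by
  have key : ∀ i : ℕ, ∃ C : ℝ, 0 ≤ C ∧ ∀ z : ℂ, c ≤ ‖z‖ →
      ‖iteratedFDeriv ℝ i (fun z : ℂ => z⁻¹) z‖ ≤ C := by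
    intro i
    obtain ⟨C, hC0, hC⟩ := aux_homog (fun z : ℂ => z⁻¹) (-1)
      (fun z hz => (contDiffAt_inv ℝ hz)) (by
        intro t ht z
        rw [Real.rpow_neg_one]
        simp [mul_comm]) i
    refine ⟨C * c ^ ((-1 : ℝ) - i), by positivity, fun z hz => ?_⟩
    refine (hC z (norm_pos_iff.1 (hc.trans_le hz))).trans ?_
    gcongr 1
    apply Real.rpow_le_rpow_of_nonpos hc hz
    have : (0 : ℝ) ≤ i := by positivity
    linarith
  choose K hK0 hK using key
  refine ⟨∑ i ∈ Finset.range (N + 1), K i, Finset.sum_nonneg fun i _ => hK0 i, fun i hi z hz => ?_⟩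
  exact (hK i z hz).trans (Finset.single_le_sum (f := K) (fun i _ => hK0 i) (by simp; omega))

lemma aux_quot {P : Type*} [NormedAddCommGroup P] [NormedSpace ℝ P] (c C D : ℝ) (hc : 0 < c)
    (hC : 0 ≤ C) (hD : 1 ≤ D) (N : ℕ) :
    ∃ K : ℝ, 0 ≤ K ∧ ∀ (Φ H : P → ℂ) (p : P), ContDiff ℝ (⊤ : ℕ∞) Φ → ContDiff ℝ (⊤ : ℕ∞) H →
      c ≤ ‖H p‖ → (∀ i ≤ N, ‖iteratedFDeriv ℝ i Φ p‖ ≤ C) →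
      (∀ i, 1 ≤ i → i ≤ N → ‖iteratedFDeriv ℝ i H p‖ ≤ D) →
      ‖iteratedFDeriv ℝ N (fun p => Φ p * (H p)⁻¹) p‖ ≤ K := by
  obtain ⟨Ci, hCi0, hCi⟩ := aux_inv_bound c hc N
  refine ⟨∑ i ∈ Finset.range (N + 1), (N.choose i : ℝ) * C * ((Nat.factorial (N - i) : ℝ) * Ci * D ^ (N - i)),
    Finset.sum_nonneg fun i _ => by positivity, ?_⟩
  intro Φ H p hΦ hH hcp hΦb hHb
  set t : Set ℂ := {0}ᶜ with ht
  have hto : IsOpen t := isOpen_compl_singleton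
  set U : Set P := H ⁻¹' t with hU
  have hUo : IsOpen U := hto.preimage hH.continuous
  have hp : p ∈ U := by
    simp only [hU, ht, Set.mem_preimage, Set.mem_compl_iff, Set.mem_singleton_iff]
    intro h; rw [h, norm_zero] at hcp; linarith
  have hinv : ContDiffOn ℝ (⊤ : ℕ∞) (fun z : ℂ => z⁻¹) t := fun z hz =>
    (contDiffAt_inv ℝ hz).contDiffWithinAt
  have hmt : Set.MapsTo H U t := fun x hx => hx
  have hHi : ContDiffOn ℝ (⊤ : ℕ∞) ((fun z : ℂ => z⁻¹) ∘ H) U :=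
    hinv.comp hH.contDiffOn hmt
  have hb : ∀ i ≤ N, ‖iteratedFDerivWithin ℝ i ((fun z : ℂ => z⁻¹) ∘ H) U p‖ ≤ (Nat.factorial i : ℝ) * Ci * D ^ i := by
    intro i hi
    refine norm_iteratedFDerivWithin_comp_le hinv hH.contDiffOn (by exact_mod_cast le_top)
      hto.uniqueDiffOn hUo.uniqueDiffOn hmt hp ?_ ?_
    · intro j hj
      rw [iteratedFDerivWithin_of_isOpen j hto (hmt hp)]
      exact hCi j (hj.trans hi) _ hcp
    · intro j hj1 hj
      rw [iteratedFDerivWithin_of_isOpen j hUo hp]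
      exact (hHb j hj1 (hj.trans hi)).trans (le_self_pow₀ hD (by omega))
  have := norm_iteratedFDerivWithin_mul_le (𝕜 := ℝ) (hΦ.contDiffOn (s := U)) hHi
    hUo.uniqueDiffOn hp (n := N) (by exact_mod_cast le_top)
  rw [iteratedFDerivWithin_of_isOpen N hUo hp] at this
  refine this.trans (Finset.sum_le_sum fun i hi => ?_)
  have hi' : i ≤ N := by simp at hi; omega
  rw [iteratedFDerivWithin_of_isOpen i hUo hp]
  gcongr
  · exact hΦb i hi'
  · exact hb _ (by omega)

lemma aux_clm {E V : Type*} [NormedAddCommGroup E] [NormedSpace ℝ E]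
    [NormedAddCommGroup V] [NormedSpace ℝ V] (L : E →L[ℝ] V) (j : ℕ) (hj : 1 ≤ j) (x : E) :
    ‖iteratedFDeriv ℝ j (fun y => L y) x‖ ≤ ‖L‖ := by
  obtain ⟨i, rfl⟩ : ∃ i, j = i + 1 := ⟨j - 1, by omega⟩
  rw [← norm_iteratedFDeriv_fderiv]
  have : fderiv ℝ (fun y => L y) = fun _ => L := by funext y; exact L.fderiv
  rw [this]
  rcases Nat.eq_zero_or_pos i with rfl | hi
  · simp
  · rw [iteratedFDeriv_const_of_ne hi.ne']; simp

lemma aux_rpow (e x : ℝ) (hx : 1 ≤ x) : x ^ e ≤ 2 ^ |e| * (1 + x) ^ e := by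
  rcases le_total 0 e with he | he
  · have h1 : x ^ e ≤ (1 + x) ^ e := Real.rpow_le_rpow (by linarith) (by linarith) he
    have h2 : (1 : ℝ) ≤ 2 ^ |e| := Real.one_le_rpow (by norm_num) (abs_nonneg _)
    have h3 : 0 ≤ (1 + x) ^ e := Real.rpow_nonneg (by linarith) _
    nlinarith
  · have h1 : x ^ e ≤ ((1 + x) / 2) ^ e :=
      Real.rpow_le_rpow_of_nonpos (by linarith) (by linarith) he
    rw [Real.div_rpow (by linarith) (by norm_num)] at h1
    rw [abs_of_nonpos he, Real.rpow_neg (by norm_num)]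
    rwa [div_eq_inv_mul] at h1

lemma aux_far {E V : Type*} [NormedAddCommGroup E] [NormedSpace ℝ E] [FiniteDimensional ℝ E]
    [NormedAddCommGroup V] [NormedSpace ℝ V] {f : E → V} (hf : ContDiff ℝ (⊤ : ℕ∞) f)
    (j : ℕ) (e : ℝ) (C : ℝ)
    (h : ∀ x, 2 < ‖x‖ → ‖iteratedFDeriv ℝ j f x‖ ≤ C * (1 + ‖x‖) ^ e) :
    ∃ C : ℝ, 0 ≤ C ∧ ∀ x, ‖iteratedFDeriv ℝ j f x‖ ≤ C * (1 + ‖x‖) ^ e := by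
  have : ProperSpace E := FiniteDimensional.proper ℝ E
  have hpos : ∀ x : E, 0 < (1 + ‖x‖) ^ e := fun x => by positivity
  have hc : Continuous (fun x : E => ‖iteratedFDeriv ℝ j f x‖ / (1 + ‖x‖) ^ e) := by
    have h1 : Continuous (iteratedFDeriv ℝ j f) :=
      hf.continuous_iteratedFDeriv (by exact_mod_cast le_top)
    refine h1.norm.div ?_ (fun x => (hpos x).ne')
    exact (continuous_const.add continuous_norm).rpow_const
      (fun x => Or.inl (ne_of_gt (add_pos_of_pos_of_nonneg one_pos (norm_nonneg x))))
  obtain ⟨C', hC'⟩ := (isCompact_closedBall (0 : E) 2).exists_bound_of_continuousOn hc.continuousOn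
  refine ⟨max (max C C') 0, le_max_right _ _, fun x => ?_⟩
  by_cases hx : 2 < ‖x‖
  · refine (h x hx).trans ?_
    have := (hpos x).le
    gcongr
    exact (le_max_left _ _).trans (le_max_left _ _)
  · have h1 := hC' x (by simpa using hx)
    rw [Real.norm_of_nonneg (by positivity), div_le_iff₀ (hpos x)] at h1
    refine h1.trans ?_
    have := (hpos x).le
    gcongr
    exact (le_max_right _ _).trans (le_max_left _ _)

lemma aux_drift {E : Type*} [NormedAddCommGroup E] [InnerProductSpace ℝ E]
    {ν : E → E} (hν : ContDiff ℝ (⊤ : ℕ∞) ν)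
    (hνb : ∀ i : ℕ, ∃ C : ℝ, ∀ x, ‖iteratedFDeriv ℝ i ν x‖ ≤ C) (N : ℕ) (hN : 1 ≤ N) :
    ∃ K : ℝ, 0 ≤ K ∧ ∀ (a : ℝ) (x₀ : E) (p : E × E), 0 < a → a ≤ 1 → a * ‖p.2‖ ≤ 1 →
      ‖iteratedFDeriv ℝ N (fun p : E × E => ⟪ν (a • p.1 + x₀), p.2⟫) p‖ ≤ K := by
  choose C hC using hνb
  have hC0 : ∀ i, 0 ≤ C i := fun i => (norm_nonneg _).trans (hC i 0)
  let B := (isBoundedBilinearMap_inner (𝕜 := ℝ) (E := E)).toContinuousLinearMap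
  refine ⟨‖B‖ * ∑ i ∈ Finset.range (N + 1), (N.choose i : ℝ) * C i,
    mul_nonneg B.opNorm_nonneg (Finset.sum_nonneg fun i _ => mul_nonneg (by positivity) (hC0 i)), ?_⟩
  intro a x₀ p ha0 ha1 hap
  have hsnd : ‖ContinuousLinearMap.snd ℝ E E‖ ≤ 1 := ContinuousLinearMap.norm_snd_le ..
  let A : E × E →L[ℝ] E := a • ContinuousLinearMap.fst ℝ E E
  have hA : ‖A‖ ≤ a := by
    refine ContinuousLinearMap.opNorm_le_bound _ ha0.le fun y => ?_
    change ‖a • y.1‖ ≤ a * ‖y‖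
    rw [norm_smul, Real.norm_of_nonneg ha0.le]
    exact mul_le_mul_of_nonneg_left (norm_fst_le y) ha0.le
  have hf : ContDiff ℝ (⊤ : ℕ∞) (fun p : E × E => ν (A p + x₀)) :=
    hν.comp (A.contDiff.add contDiff_const)
  have hg : ContDiff ℝ (⊤ : ℕ∞) (fun p : E × E => ContinuousLinearMap.snd ℝ E E p) :=
    ContinuousLinearMap.contDiff _
  have key := B.norm_iteratedFDeriv_le_of_bilinear hf hg p (n := N) (by exact_mod_cast le_top)
  refine le_trans (le_of_eq rfl) (key.trans ?_)
  refine mul_le_mul_of_nonneg_left (Finset.sum_le_sum fun i hi => ?_) B.opNorm_nonneg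
  have hi' : i ≤ N := by simp at hi; omega
  have h1 : ‖iteratedFDeriv ℝ i (fun p : E × E => ν (A p + x₀)) p‖ ≤ C i * a ^ i := by
    refine (aux_comp_affine_norm hν A x₀ i p).trans ?_
    have := hC0 i
    gcongr
    exact hC i _
  have h2 : a ^ i * ‖iteratedFDeriv ℝ (N - i)
      (fun p : E × E => ContinuousLinearMap.snd ℝ E E p) p‖ ≤ 1 := by
    rcases Nat.lt_or_ge i N with hlt | hge
    · have h3 := (aux_clm (ContinuousLinearMap.snd ℝ E E) (N - i) (by omega) p).trans hsnd
      have h4 : a ^ i ≤ 1 := pow_le_one₀ ha0.le ha1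
      exact mul_le_one₀ h4 (norm_nonneg _) h3
    · have : i = N := le_antisymm hi' hge
      subst this
      rw [Nat.sub_self, norm_iteratedFDeriv_zero]
      obtain ⟨l, rfl⟩ : ∃ l, i = l + 1 := ⟨i - 1, by omega⟩
      rw [pow_succ, mul_assoc]
      exact mul_le_one₀ (pow_le_one₀ ha0.le ha1) (by positivity) hap
  set M : ℝ := ‖iteratedFDeriv ℝ (N - i)
    (fun p : E × E => ContinuousLinearMap.snd ℝ E E p) p‖ with hM
  have hM0 : 0 ≤ M := norm_nonneg _
  calc _ ≤ (N.choose i : ℝ) * (C i * a ^ i) * M := by gcongr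
    _ = (N.choose i : ℝ) * C i * (a ^ i * M) := by ring
    _ ≤ (N.choose i : ℝ) * C i * 1 := by
      have := hC0 i
      gcongr
    _ = _ := by ring

/-- The cut-off equals one on the closed exterior region. -/
lemma aux_phi_one {E : Type*} [NormedAddCommGroup E] [NormedSpace ℝ E]
    {φ : E → ℝ} (hφ : ContDiff ℝ (⊤ : ℕ∞) φ)
    (hφ1 : ∀ ξ : E, 2 < ‖ξ‖ → φ ξ = 1) (ξ : E) (hξ : 1 ≤ ‖ξ‖) : φ ((2 : ℝ) • ξ) = 1 := by
  have hcl : IsClosed {t : ℝ | φ (t • ξ) = 1} :=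
    isClosed_eq (hφ.continuous.comp (continuous_id.smul continuous_const)) continuous_const
  have hsub : Set.Ioi (2 : ℝ) ⊆ {t : ℝ | φ (t • ξ) = 1} := by
    intro t ht
    have ht' : (2 : ℝ) < t := ht
    apply hφ1
    rw [norm_smul, Real.norm_of_nonneg (by linarith)]
    nlinarith
  have := hcl.closure_subset_iff.2 hsub
  rw [closure_Ioi] at this
  exact this (Set.mem_Ici.2 le_rfl)

lemma aux_g {E : Type*} [NormedAddCommGroup E] [InnerProductSpace ℝ E] [FiniteDimensional ℝ E]
    (s : ℝ) {φ : E → ℝ} (hφ : ContDiff ℝ (⊤ : ℕ∞) φ)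
    (hφ0 : ∀ ξ : E, ‖ξ‖ < 1 → φ ξ = 0)
    (hφ1 : ∀ ξ : E, 2 < ‖ξ‖ → φ ξ = 1) :
    ContDiff ℝ (⊤ : ℕ∞) (fun ξ : E => ‖ξ‖ ^ (2 * s) * φ ((2 : ℝ) • ξ)) ∧
    ∀ j : ℕ, ∃ C : ℝ, 0 ≤ C ∧ ∀ ξ,
      ‖iteratedFDeriv ℝ j (fun ξ : E => ‖ξ‖ ^ (2 * s) * φ ((2 : ℝ) • ξ)) ξ‖
        ≤ C * (1 + ‖ξ‖) ^ (2 * s - j) := by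
  have hpow : ∀ x : E, x ≠ 0 → ContDiffAt ℝ (⊤ : ℕ∞) (fun ξ : E => ‖ξ‖ ^ (2 * s)) x := fun x hx =>
    (contDiffAt_norm ℝ hx).rpow_const_of_ne (norm_ne_zero_iff.2 hx)
  have hφ2 : ContDiff ℝ (⊤ : ℕ∞) (fun ξ : E => φ ((2 : ℝ) • ξ)) :=
    hφ.comp (contDiff_id.const_smul (2 : ℝ))
  have hsm : ContDiff ℝ (⊤ : ℕ∞) (fun ξ : E => ‖ξ‖ ^ (2 * s) * φ ((2 : ℝ) • ξ)) := by
    rw [contDiff_iff_contDiffAt]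
    intro x
    by_cases hx : x = 0
    · subst hx
      have : (fun ξ : E => ‖ξ‖ ^ (2 * s) * φ ((2 : ℝ) • ξ)) =ᶠ[nhds 0] fun _ => 0 := by
        filter_upwards [Metric.ball_mem_nhds (0 : E) (show (0 : ℝ) < 1 / 2 by norm_num)] with y hy
        rw [hφ0, mul_zero]
        rw [mem_ball_zero_iff] at hy
        rw [norm_smul, Real.norm_of_nonneg (by norm_num)]
        linarith
      exact contDiffAt_const.congr_of_eventuallyEq this
    · exact (hpow x hx).mul hφ2.contDiffAt
  refine ⟨hsm, fun j => ?_⟩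
  obtain ⟨C, hC0, hC⟩ := aux_homog (fun ξ : E => ‖ξ‖ ^ (2 * s)) (2 * s) hpow (by
    intro t ht x
    rw [norm_smul, Real.norm_of_nonneg ht.le, Real.mul_rpow ht.le (norm_nonneg _)]
    rfl) j
  refine aux_far hsm j (2 * s - j) (C * 2 ^ |2 * s - j|) fun x hx => ?_
  have hev : (fun ξ : E => ‖ξ‖ ^ (2 * s) * φ ((2 : ℝ) • ξ)) =ᶠ[nhds x]
      fun ξ => ‖ξ‖ ^ (2 * s) := by
    have : {y : E | 1 < ‖y‖} ∈ nhds x :=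
      (isOpen_lt continuous_const continuous_norm).mem_nhds (show 1 < ‖x‖ by linarith)
    filter_upwards [this] with y hy
    rw [aux_phi_one hφ hφ1 y (le_of_lt hy), mul_one]
  rw [(Filter.EventuallyEq.iteratedFDeriv ℝ hev j).eq_of_nhds]
  refine (hC x (norm_pos_iff.1 (by linarith))).trans ?_
  rw [mul_assoc]
  gcongr
  exact aux_rpow _ _ (by linarith)

lemma aux_phi {E : Type*} [NormedAddCommGroup E] [InnerProductSpace ℝ E] [FiniteDimensional ℝ E]
    (s : ℝ) {φ : E → ℝ} (hφ : ContDiff ℝ (⊤ : ℕ∞) φ)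
    (hφ1 : ∀ ξ : E, 2 < ‖ξ‖ → φ ξ = 1) (j : ℕ) :
    ∃ C : ℝ, 0 ≤ C ∧ ∀ ξ, ‖iteratedFDeriv ℝ j φ ξ‖ ≤ C * (1 + ‖ξ‖) ^ (-(2 * s * j)) := by
  refine aux_far hφ j _ 1 fun x hx => ?_
  have hev : φ =ᶠ[nhds x] fun ξ => 1 := by
    have : {y : E | 2 < ‖y‖} ∈ nhds x :=
      (isOpen_lt continuous_const continuous_norm).mem_nhds hx
    filter_upwards [this] with y hy
    exact hφ1 y hy
  rw [(Filter.EventuallyEq.iteratedFDeriv ℝ hev j).eq_of_nhds]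
  rcases Nat.eq_zero_or_pos j with rfl | hj
  · simp
  · rw [iteratedFDeriv_const_of_ne hj.ne']
    simp only [Pi.zero_apply, norm_zero]
    positivity
lemma aux_smooth {E : Type*} [NormedAddCommGroup E] [InnerProductSpace ℝ E]
    {g : E → ℝ} {ν : E → E} (hg : ContDiff ℝ (⊤ : ℕ∞) g) (hν : ContDiff ℝ (⊤ : ℕ∞) ν) :
    ContDiff ℝ (⊤ : ℕ∞) (fun p : E × E =>
      ((g p.2 : ℝ) : ℂ) + Complex.I * ((⟪ν p.1, p.2⟫ : ℝ) : ℂ)) := by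
  have h1 : ContDiff ℝ (⊤ : ℕ∞) (fun p : E × E => ((g p.2 : ℝ) : ℂ)) :=
    Complex.ofRealCLM.contDiff.comp (hg.comp contDiff_snd)
  have h2 : ContDiff ℝ (⊤ : ℕ∞) (fun p : E × E => ((⟪ν p.1, p.2⟫ : ℝ) : ℂ)) :=
    Complex.ofRealCLM.contDiff.comp ((hν.comp contDiff_fst).inner ℝ contDiff_snd)
  exact h1.add (contDiff_const.mul h2)

/-- Uniform joint bound for the rescaled symbol. -/
lemma aux_rescaled {E : Type*} [NormedAddCommGroup E] [InnerProductSpace ℝ E]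
    [FiniteDimensional ℝ E] (s : ℝ) (hs0 : 0 < s) (hs2 : s < 1 / 2)
    {ν : E → E} (hν : ContDiff ℝ (⊤ : ℕ∞) ν)
    (hνb : ∀ i : ℕ, ∃ C : ℝ, ∀ x, ‖iteratedFDeriv ℝ i ν x‖ ≤ C)
    {φ : E → ℝ} (hφ : ContDiff ℝ (⊤ : ℕ∞) φ)
    (hφ0 : ∀ ξ : E, ‖ξ‖ < 1 → φ ξ = 0)
    (hφ1 : ∀ ξ : E, 2 < ‖ξ‖ → φ ξ = 1) (N : ℕ) :
    ∃ K : ℝ, 0 ≤ K ∧ ∀ (R a b : ℝ) (x₀ ξ₀ : E), 1 ≤ ‖ξ₀‖ → R = 1 + ‖ξ₀‖ → a = R ^ (2 * s - 1) →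
      b = R ^ (2 * s) →
      ‖iteratedFDeriv ℝ N (fun p : E × E => ((φ (b • p.2) : ℝ) : ℂ) *
        (((R ^ (-(2 * s)) * (‖b • p.2‖ ^ (2 * s) * φ ((2 : ℝ) • (b • p.2))) : ℝ) : ℂ) +
          Complex.I * ((⟪ν (a • p.1 + x₀), p.2⟫ : ℝ) : ℂ))⁻¹) (0, b⁻¹ • ξ₀)‖ ≤ K := by
  obtain ⟨hgs, hgb⟩ := aux_g s hφ hφ0 hφ1
  set g : E → ℝ := fun ξ => ‖ξ‖ ^ (2 * s) * φ ((2 : ℝ) • ξ) with hgdef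
  choose Cg hCg0 hCg using hgb
  choose Cp hCp0 hCp using aux_phi s hφ hφ1
  have hd := fun i : ℕ => aux_drift hν hνb (i + 1) (by omega)
  choose Cd hCd0 hCd using hd
  let J : ℝ →L[ℝ] ℂ := Complex.I • Complex.ofRealCLM
  have hJ : ‖J‖ ≤ 1 := by
    refine ContinuousLinearMap.opNorm_le_bound _ zero_le_one fun y => ?_
    simp [J]
  have hO : ‖Complex.ofRealCLM‖ ≤ 1 := by
    refine ContinuousLinearMap.opNorm_le_bound _ zero_le_one fun y => ?_
    simp
  set C := ∑ i ∈ Finset.range (N + 1), Cp i with hCdef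
  set D := 1 + ∑ i ∈ Finset.range (N + 1), (Cg i + Cd (i - 1)) with hDdef
  have hC0 : 0 ≤ C := Finset.sum_nonneg fun i _ => hCp0 i
  have hD1 : 1 ≤ D := by
    have : 0 ≤ ∑ i ∈ Finset.range (N + 1), (Cg i + Cd (i - 1)) :=
      Finset.sum_nonneg fun i _ => add_nonneg (hCg0 _) (hCd0 _)
    linarith
  have hc : (0 : ℝ) < (1 / 2) ^ (2 * s) := by positivity
  obtain ⟨K, hK0, hK⟩ := aux_quot (P := E × E) ((1 / 2) ^ (2 * s)) C D hc hC0 hD1 N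
  refine ⟨K, hK0, ?_⟩
  intro R a b x₀ ξ₀ hξ hR ha hb
  have hR1 : 1 ≤ R := by linarith
  have hR0 : 0 < R := by linarith
  have ha0 : 0 < a := by rw [ha]; positivity
  have hb0 : 0 < b := by rw [hb]; positivity
  have ha1 : a ≤ 1 := by
    rw [ha]; exact Real.rpow_le_one_of_one_le_of_nonpos hR1 (by linarith)
  have hbξ : b • (b⁻¹ • ξ₀) = ξ₀ := smul_inv_smul₀ hb0.ne' ξ₀
  let S : E × E →L[ℝ] E := b • ContinuousLinearMap.snd ℝ E E
  have hS : ‖S‖ ≤ b := by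
    refine ContinuousLinearMap.opNorm_le_bound _ hb0.le fun y => ?_
    change ‖b • y.2‖ ≤ b * ‖y‖
    rw [norm_smul, Real.norm_of_nonneg hb0.le]
    exact mul_le_mul_of_nonneg_left (norm_snd_le y) hb0.le
  have hSp : S (0, b⁻¹ • ξ₀) + 0 = ξ₀ := by rw [add_zero]; exact hbξ
  have hcomp : ∀ (f : E → ℝ), ContDiff ℝ (⊤ : ℕ∞) f → ∀ i,
      ‖iteratedFDeriv ℝ i (fun p : E × E => f (b • p.2)) (0, b⁻¹ • ξ₀)‖ ≤
        ‖iteratedFDeriv ℝ i f ξ₀‖ * b ^ i := by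
    intro f hf i
    have h := aux_comp_affine_norm hf S 0 i (0, b⁻¹ • ξ₀)
    rw [hSp] at h
    have h' : (fun y : E × E => f (S y + 0)) = fun p => f (b • p.2) := by
      funext y; rw [add_zero]; rfl
    rw [h'] at h
    refine h.trans ?_
    gcongr
  have hsc : ∀ f : E → ℝ, ContDiff ℝ (⊤ : ℕ∞) f →
      ContDiff ℝ (⊤ : ℕ∞) (fun p : E × E => f (b • p.2)) := fun f hf =>
    hf.comp (contDiff_snd.const_smul b)
  have hdr : ContDiff ℝ (⊤ : ℕ∞) (fun p : E × E => ⟪ν (a • p.1 + x₀), p.2⟫) :=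
    (hν.comp ((contDiff_fst.const_smul a).add contDiff_const)).inner ℝ contDiff_snd
  have hgR : ContDiff ℝ (⊤ : ℕ∞) (fun ξ => R ^ (-(2 * s)) * g ξ) := contDiff_const.mul hgs
  have hT1 : ContDiff ℝ (⊤ : ℕ∞) (fun p : E × E => (((R ^ (-(2 * s)) * g (b • p.2)) : ℝ) : ℂ)) :=
    Complex.ofRealCLM.contDiff.comp (hsc _ hgR)
  have hT2 : ContDiff ℝ (⊤ : ℕ∞)
      (fun p : E × E => Complex.I * ((⟪ν (a • p.1 + x₀), p.2⟫ : ℝ) : ℂ)) :=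
    J.contDiff.comp hdr
  refine hK (fun p => ((φ (b • p.2) : ℝ) : ℂ))
    (fun p => (((R ^ (-(2 * s)) * g (b • p.2)) : ℝ) : ℂ) +
      Complex.I * ((⟪ν (a • p.1 + x₀), p.2⟫ : ℝ) : ℂ)) (0, b⁻¹ • ξ₀)
    (Complex.ofRealCLM.contDiff.comp (hsc φ hφ)) (hT1.add hT2) ?_ ?_ ?_
  · skip
    refine le_trans ?_ (Complex.abs_re_le_norm _)
    refine le_trans ?_ (le_abs_self _)
    simp only [Complex.add_re, Complex.ofReal_re, Complex.mul_re, Complex.I_re, zero_mul,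
      Complex.ofReal_im, mul_zero, sub_zero, add_zero]
    rw [hbξ]
    simp only [hgdef]
    rw [aux_phi_one hφ hφ1 ξ₀ hξ, mul_one, Real.rpow_neg hR0.le, ← div_eq_inv_mul,
      ← Real.div_rpow (norm_nonneg _) hR0.le]
    apply Real.rpow_le_rpow (by norm_num) _ (by linarith)
    rw [div_le_div_iff₀ (by norm_num) hR0]
    linarith
  · intro i hi
    refine (Complex.ofRealCLM.norm_iteratedFDeriv_comp_left (hsc φ hφ).contDiffAt
      (by exact_mod_cast le_top)).trans ?_
    have h1 := hcomp φ hφ i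
    have h2 : ‖iteratedFDeriv ℝ i φ ξ₀‖ * b ^ i ≤ Cp i := by
      refine (mul_le_mul_of_nonneg_right (hCp i ξ₀) (by positivity)).trans (le_of_eq ?_)
      rw [← hR, hb, ← Real.rpow_natCast, ← Real.rpow_mul hR0.le, mul_assoc,
        ← Real.rpow_add hR0]
      simp
    have h3 : Cp i ≤ C := Finset.single_le_sum (f := Cp) (fun i _ => hCp0 i) (by simp; omega)
    calc _ ≤ 1 * ‖iteratedFDeriv ℝ i (fun p : E × E => φ (b • p.2)) (0, b⁻¹ • ξ₀)‖ := by gcongr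
      _ ≤ C := by linarith
  · intro i hi1 hi
    have hle : ((i : ℕ) : WithTop ℕ∞) ≤ ((⊤ : ℕ∞) : WithTop ℕ∞) := by exact_mod_cast le_top
    have hadd := fun_iteratedFDeriv_add_apply (𝕜 := ℝ) (i := i) (x := ((0 : E), b⁻¹ • ξ₀))
      (hT1.contDiffAt.of_le hle) (hT2.contDiffAt.of_le hle)
    rw [hadd]
    refine (norm_add_le _ _).trans ?_
    have hA : ‖iteratedFDeriv ℝ i (fun p : E × E => (((R ^ (-(2 * s)) * g (b • p.2)) : ℝ) : ℂ))
        (0, b⁻¹ • ξ₀)‖ ≤ Cg i := by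
      refine (Complex.ofRealCLM.norm_iteratedFDeriv_comp_left (hsc _ hgR).contDiffAt hle).trans ?_
      have h1 := hcomp _ hgR i
      have h2 : ‖iteratedFDeriv ℝ i (fun ξ => R ^ (-(2 * s)) * g ξ) ξ₀‖ =
          R ^ (-(2 * s)) * ‖iteratedFDeriv ℝ i g ξ₀‖ := by
        have h := iteratedFDeriv_const_smul_apply' (𝕜 := ℝ) (i := i) (x := ξ₀)
          (a := R ^ (-(2 * s))) (hgs.contDiffAt.of_le hle)
        simp only [smul_eq_mul] at h
        rw [h, norm_smul, Real.norm_of_nonneg (by positivity)]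
      have h3 : R ^ (-(2 * s)) * ‖iteratedFDeriv ℝ i g ξ₀‖ * b ^ i ≤ Cg i := by
        have h4 : R ^ (-(2 * s)) * (Cg i * R ^ (2 * s - i)) * b ^ i =
            Cg i * R ^ ((2 * s - 1) * i) := by
          rw [hb, ← Real.rpow_natCast, ← Real.rpow_mul hR0.le,
            show R ^ (-(2 * s)) * (Cg i * R ^ (2 * s - i)) * R ^ (2 * s * i) =
              Cg i * (R ^ (-(2 * s)) * R ^ (2 * s - i) * R ^ (2 * s * i)) by ring,
            ← Real.rpow_add hR0, ← Real.rpow_add hR0]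
          congr 2; ring
        have h5 : R ^ ((2 * s - 1) * i) ≤ 1 :=
          Real.rpow_le_one_of_one_le_of_nonpos hR1
            (mul_nonpos_of_nonpos_of_nonneg (by linarith) (by positivity))
        have h6 := hCg i ξ₀
        rw [← hR] at h6
        calc _ ≤ R ^ (-(2 * s)) * (Cg i * R ^ (2 * s - i)) * b ^ i := by gcongr
          _ = Cg i * R ^ ((2 * s - 1) * i) := h4
          _ ≤ Cg i * 1 := mul_le_mul_of_nonneg_left h5 (hCg0 i)
          _ = Cg i := mul_one _
      rw [h2] at h1
      calc _ ≤ 1 * ‖iteratedFDeriv ℝ i (fun p : E × E => R ^ (-(2 * s)) * g (b • p.2))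
            (0, b⁻¹ • ξ₀)‖ := by gcongr
        _ ≤ Cg i := by linarith
    have hB : ‖iteratedFDeriv ℝ i
        (fun p : E × E => Complex.I * ((⟪ν (a • p.1 + x₀), p.2⟫ : ℝ) : ℂ))
        (0, b⁻¹ • ξ₀)‖ ≤ Cd (i - 1) := by
      refine (J.norm_iteratedFDeriv_comp_left hdr.contDiffAt hle).trans ?_
      have h1 := hCd (i - 1) a x₀ (0, b⁻¹ • ξ₀) ha0 ha1 (by
        simp only [norm_smul, norm_inv, Real.norm_of_nonneg hb0.le]
        rw [← mul_assoc, ha, hb, ← Real.rpow_neg hR0.le, ← Real.rpow_add hR0,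
          show 2 * s - 1 + -(2 * s) = -1 by ring, Real.rpow_neg_one, inv_mul_le_iff₀ hR0]
        linarith)
      rw [Nat.sub_add_cancel hi1] at h1
      calc _ ≤ 1 * ‖iteratedFDeriv ℝ i (fun p : E × E => ⟪ν (a • p.1 + x₀), p.2⟫)
            (0, b⁻¹ • ξ₀)‖ := by gcongr
        _ ≤ _ := by linarith
    have h3 := Finset.single_le_sum (f := fun i => Cg i + Cd (i - 1))
      (s := Finset.range (N + 1)) (fun i _ => add_nonneg (hCg0 _) (hCd0 _)) (a := i)
      (by simp; omega)
    linarith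

end helpers

/-- For `s ∈ (0,1/2)`, `ν` smooth with bounded derivatives of all orders, and `φ` a
smooth cut-off vanishing for `|ξ| < 1` and equal to `1` for `|ξ| > 2`, the symbol
`q₁(x,ξ) = φ(ξ)/ã(x,ξ)` is smooth and lies in the Hörmander class `S^{-2s}_{2s,1-2s}`:
all mixed derivatives of order `k` in `x` and `m` in `ξ` are bounded by
`C (1+|ξ|)^{-2s-2sm+(1-2s)k}`. -/
theorem stmt_15 (n : ℕ) (hn : 1 ≤ n) (s : ℝ) (hs0 : 0 < s) (hs2 : s < 1 / 2)
    (ν : EuclideanSpace ℝ (Fin n) → EuclideanSpace ℝ (Fin n))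
    (hν : ContDiff ℝ (⊤ : ℕ∞) ν)
    (hνb : ∀ i : ℕ, ∃ C : ℝ, ∀ x, ‖iteratedFDeriv ℝ i ν x‖ ≤ C)
    (φ : EuclideanSpace ℝ (Fin n) → ℝ)
    (hφ : ContDiff ℝ (⊤ : ℕ∞) φ)
    (hφ01 : ∀ ξ, φ ξ ∈ Set.Icc (0 : ℝ) 1)
    (hφ0 : ∀ ξ : EuclideanSpace ℝ (Fin n), ‖ξ‖ < 1 → φ ξ = 0)
    (hφ1 : ∀ ξ : EuclideanSpace ℝ (Fin n), 2 < ‖ξ‖ → φ ξ = 1) :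
    ContDiff ℝ (⊤ : ℕ∞)
      (fun p : EuclideanSpace ℝ (Fin n) × EuclideanSpace ℝ (Fin n) =>
        parametrixSymbol s ν φ p.1 p.2) ∧
    ∀ k m : ℕ, ∃ C : ℝ, ∀ x ξ : EuclideanSpace ℝ (Fin n),
      ‖iteratedFDeriv ℝ m
          (fun ξ' => iteratedFDeriv ℝ k (fun x' => parametrixSymbol s ν φ x' ξ') x) ξ‖
        ≤ C * (1 + ‖ξ‖) ^ (-(2 * s) - 2 * s * (m : ℝ) + (1 - 2 * s) * (k : ℝ)) := by
  obtain ⟨hgs, -⟩ := aux_g s hφ hφ0 hφ1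
  have hsym : ContDiff ℝ (⊤ : ℕ∞)
      (fun p : EuclideanSpace ℝ (Fin n) × EuclideanSpace ℝ (Fin n) =>
        smoothedSymbol s ν φ p.1 p.2) := aux_smooth hgs hν
  have hne : ∀ x ξ : EuclideanSpace ℝ (Fin n), 1 ≤ ‖ξ‖ → smoothedSymbol s ν φ x ξ ≠ 0 := by
    intro x ξ hξ h
    have := congrArg Complex.re h
    simp only [smoothedSymbol, Complex.add_re, Complex.ofReal_re, Complex.mul_re, Complex.I_re,
      zero_mul, Complex.ofReal_im, mul_zero, sub_zero, add_zero, Complex.zero_re] at this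
    rw [aux_phi_one hφ hφ1 ξ hξ, mul_one] at this
    have h2 : 0 < ‖ξ‖ ^ (2 * s) := Real.rpow_pos_of_pos (by linarith) _
    linarith
  have hq : ContDiff ℝ (⊤ : ℕ∞)
      (fun p : EuclideanSpace ℝ (Fin n) × EuclideanSpace ℝ (Fin n) =>
        parametrixSymbol s ν φ p.1 p.2) := by
    rw [contDiff_iff_contDiffAt]
    intro p
    by_cases hp : 1 ≤ ‖p.2‖
    · have h1 : ContDiff ℝ (⊤ : ℕ∞)
          (fun p : EuclideanSpace ℝ (Fin n) × EuclideanSpace ℝ (Fin n) => ((φ p.2 : ℝ) : ℂ)) :=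
        Complex.ofRealCLM.contDiff.comp (hφ.comp contDiff_snd)
      have h2 := h1.contDiffAt.mul (hsym.contDiffAt.inv (hne p.1 p.2 hp))
      simp only [parametrixSymbol, div_eq_mul_inv]
      exact h2
    · have hev : (fun p : EuclideanSpace ℝ (Fin n) × EuclideanSpace ℝ (Fin n) =>
          parametrixSymbol s ν φ p.1 p.2) =ᶠ[nhds p] fun _ => 0 := by
        have : {y : EuclideanSpace ℝ (Fin n) × EuclideanSpace ℝ (Fin n) | ‖y.2‖ < 1} ∈ nhds p :=
          (isOpen_lt continuous_snd.norm continuous_const).mem_nhds (not_le.1 hp)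
        filter_upwards [this] with y hy
        simp [parametrixSymbol, hφ0 y.2 hy]
      exact contDiffAt_const.congr_of_eventuallyEq hev
  refine ⟨hq, fun k m => ?_⟩
  obtain ⟨K, hK0, hK⟩ := aux_rescaled s hs0 hs2 hν hνb hφ hφ0 hφ1 (k + m)
  refine ⟨K, fun x ξ => ?_⟩
  by_cases hξ : 1 ≤ ‖ξ‖
  swap
  · have hev : (fun ξ' => iteratedFDeriv ℝ k (fun x' => parametrixSymbol s ν φ x' ξ') x)
        =ᶠ[nhds ξ] fun _ => 0 := by
      have : {y : EuclideanSpace ℝ (Fin n) | ‖y‖ < 1} ∈ nhds ξ :=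
        (isOpen_lt continuous_norm continuous_const).mem_nhds (not_le.1 hξ)
      filter_upwards [this] with y hy
      have h0 : (fun x' => parametrixSymbol s ν φ x' y) = fun _ => 0 := by
        funext x'; simp [parametrixSymbol, hφ0 y hy]
      rw [h0]
      simp
    rw [(Filter.EventuallyEq.iteratedFDeriv ℝ hev m).eq_of_nhds]
    simp only [iteratedFDeriv_fun_zero, Pi.zero_apply, norm_zero]
    positivity
  set R : ℝ := 1 + ‖ξ‖ with hR
  have hR0 : 0 < R := by positivity
  set a : ℝ := R ^ (2 * s - 1) with ha
  set b : ℝ := R ^ (2 * s) with hb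
  have ha0 : 0 < a := by rw [ha]; positivity
  have hb0 : 0 < b := by rw [hb]; positivity
  let F : EuclideanSpace ℝ (Fin n) × EuclideanSpace ℝ (Fin n) → ℂ := fun p =>
    parametrixSymbol s ν φ (a • p.1 + x) (b • p.2)
  have hF : ContDiff ℝ (⊤ : ℕ∞) F :=
    hq.comp (((contDiff_fst.const_smul a).add contDiff_const).prodMk (contDiff_snd.const_smul b))
  have hFb : ‖iteratedFDeriv ℝ (k + m) F (0, b⁻¹ • ξ)‖ ≤ K * R ^ (-(2 * s)) := by
    have h1 := hK R a b x ξ hξ hR ha hb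
    have h2 : (fun p : EuclideanSpace ℝ (Fin n) × EuclideanSpace ℝ (Fin n) =>
        ((φ (b • p.2) : ℝ) : ℂ) *
        (((R ^ (-(2 * s)) * (‖b • p.2‖ ^ (2 * s) * φ ((2 : ℝ) • (b • p.2))) : ℝ) : ℂ) +
          Complex.I * ((⟪ν (a • p.1 + x), p.2⟫ : ℝ) : ℂ))⁻¹) = b • F := by
      funext p
      have hbb : R ^ (-(2 * s)) = b⁻¹ := by rw [Real.rpow_neg hR0.le]
      have hbc : (b : ℂ) ≠ 0 := by exact_mod_cast hb0.ne'
      have h3 : smoothedSymbol s ν φ (a • p.1 + x) (b • p.2) = (b : ℂ) *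
        (((R ^ (-(2 * s)) * (‖b • p.2‖ ^ (2 * s) * φ ((2 : ℝ) • (b • p.2))) : ℝ) : ℂ) +
          Complex.I * ((⟪ν (a • p.1 + x), p.2⟫ : ℝ) : ℂ)) := by
        rw [hbb, smoothedSymbol, inner_smul_right]
        push_cast
        field_simp
      simp only [Pi.smul_apply, F, parametrixSymbol, Complex.real_smul]
      rw [h3, div_eq_mul_inv, mul_inv]
      field_simp
    rw [h2, iteratedFDeriv_const_smul_apply (hF.contDiffAt.of_le (by exact_mod_cast le_top)),
      norm_smul, Real.norm_of_nonneg hb0.le] at h1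
    rw [Real.rpow_neg hR0.le, ← div_eq_mul_inv, le_div_iff₀ (by positivity)]
    linarith
  let A : EuclideanSpace ℝ (Fin n) →L[ℝ] EuclideanSpace ℝ (Fin n) × EuclideanSpace ℝ (Fin n) :=
    a⁻¹ • ContinuousLinearMap.inl ℝ _ _
  let B : EuclideanSpace ℝ (Fin n) →L[ℝ] EuclideanSpace ℝ (Fin n) × EuclideanSpace ℝ (Fin n) :=
    b⁻¹ • ContinuousLinearMap.inr ℝ _ _
  have hA : ‖A‖ ≤ a⁻¹ := by
    refine ContinuousLinearMap.opNorm_le_bound _ (by positivity) fun y => ?_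
    simp [A, Prod.norm_def, norm_smul, abs_of_pos ha0]
    positivity
  have hB : ‖B‖ ≤ b⁻¹ := by
    refine ContinuousLinearMap.opNorm_le_bound _ (by positivity) fun y => ?_
    simp [B, Prod.norm_def, norm_smul, abs_of_pos hb0]
    positivity
  have hmix := aux_mixed hF A B (-(a⁻¹ • x), 0) k m x ξ
  have hpt : A x + (B ξ + (-(a⁻¹ • x), 0)) = (0, b⁻¹ • ξ) := by
    simp [A, B]
  have hfun : (fun ξ' => iteratedFDeriv ℝ k
      (fun x' => F (A x' + (B ξ' + (-(a⁻¹ • x), 0)))) x) =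
      fun ξ' => iteratedFDeriv ℝ k (fun x' => parametrixSymbol s ν φ x' ξ') x := by
    funext ξ'
    congr 1
    funext x'
    simp only [F, A, B]
    congr 1
    · simp [smul_smul, ha0.ne']
    · simp [smul_smul, hb0.ne']
  rw [hfun, hpt] at hmix
  refine hmix.trans ?_
  calc _ ≤ a⁻¹ ^ k * (K * R ^ (-(2 * s)) * b⁻¹ ^ m) := by gcongr
    _ = _ := by
      rw [ha, hb, ← Real.rpow_neg hR0.le, ← Real.rpow_neg hR0.le, ← Real.rpow_natCast,
        ← Real.rpow_natCast, ← Real.rpow_mul hR0.le, ← Real.rpow_mul hR0.le]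
      rw [show R ^ (-(2 * s - 1) * (k : ℝ)) * (K * R ^ (-(2 * s)) * R ^ (-(2 * s) * (m : ℝ))) =
        K * (R ^ (-(2 * s - 1) * (k : ℝ)) * R ^ (-(2 * s)) * R ^ (-(2 * s) * (m : ℝ))) by ring,
        ← Real.rpow_add hR0, ← Real.rpow_add hR0]
      congr 2; ring
end

section
/- Let n ≥ 1, let ν : ℝⁿ → ℝⁿ be a smooth vector field, and let x₀ ∈ ℝⁿ with ν(x₀) ≠ 0. Then, after choosing Euclidean coordinates in which ν(x₀)·e_n ≠ 0, there exist r > 0, a constant C > 0, and a map Φ : ℝⁿ → ℝⁿ such that: (i) Φ is a bijection, and both Φ and Φ^{−1} are smooth with bounded derivatives of all orders; (ii) for all x, y ∈ ℝⁿ the linear map H(x,y) = ∫_0^1 DΦ(x + t(y−x)) dt is invertible, and the map (x,y) ↦ H(x,y)^{−1} is smooth on ℝⁿ × ℝⁿ with bounded derivatives of all orders; (iii) C^{−1}|η| ≤ |((DΦ(y))^{−1})^T η| ≤ C|η| for all y, η ∈ ℝⁿ; and (iv) for every continuously differentiable function u : ℝⁿ → ℝ and every y ∈ ℝⁿ with Φ(y)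 ∈ B_r(x₀), one has ν(Φ(y)) · ∇u(Φ(y)) = ∂_{y_n}(u ∘ Φ)(y). -/
open scoped RealInnerProductSpace
open scoped unitInterval Topology ContDiff
open MeasureTheory

set_option linter.unusedSectionVars false

namespace Straighten

/-- Continuous paths on the unit interval with the sup norm. -/
def Pth (E : Type) [NormedAddCommGroup E] : Type := C(I, E)

section Pth
variable {E : Type} [NormedAddCommGroup E]

noncomputable instance : NormedAddCommGroup (Pth E) :=
  inferInstanceAs (NormedAddCommGroup C(I, E))

noncomputable instance [NormedSpace ℝ E] : NormedSpace ℝ (Pth E) :=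
  inferInstanceAs (NormedSpace ℝ C(I, E))

instance [CompleteSpace E] : CompleteSpace (Pth E) :=
  inferInstanceAs (CompleteSpace C(I, E))

instance : FunLike (Pth E) I E := inferInstanceAs (FunLike C(I, E) I E)

instance : ContinuousMapClass (Pth E) I E := inferInstanceAs (ContinuousMapClass C(I, E) I E)

/-- Constructor for paths. -/
def Pth.mk (f : I → E) (hf : Continuous f) : Pth E := (⟨f, hf⟩ : C(I, E))

@[simp] lemma Pth.mk_apply (f : I → E) (hf : Continuous f) (t : I) : Pth.mk f hf t = f t := rfl

@[ext] lemma Pth.ext {a b : Pth E} (h : ∀ t, a t = b t) : a = b := DFunLike.ext _ _ h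

@[simp] lemma Pth.add_apply (a b : Pth E) (t : I) : (a + b) t = a t + b t := rfl
@[simp] lemma Pth.sub_apply (a b : Pth E) (t : I) : (a - b) t = a t - b t := rfl
@[simp] lemma Pth.zero_apply (t : I) : (0 : Pth E) t = 0 := rfl
@[simp] lemma Pth.smul_apply [NormedSpace ℝ E] (c : ℝ) (a : Pth E) (t : I) :
    (c • a) t = c • a t := rfl

lemma Pth.norm_le {a : Pth E} {K : ℝ} (hK : 0 ≤ K) : ‖a‖ ≤ K ↔ ∀ t, ‖a t‖ ≤ K :=
  ContinuousMap.norm_le (f := (a : C(I, E))) hK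

lemma Pth.norm_coe_le_norm (a : Pth E) (t : I) : ‖a t‖ ≤ ‖a‖ :=
  ContinuousMap.norm_coe_le_norm (f := (a : C(I, E))) t

lemma Pth.dist_coe_le_dist (a b : Pth E) (t : I) : dist (a t) (b t) ≤ dist a b :=
  ContinuousMap.dist_apply_le_dist (f := (a : C(I, E))) (g := (b : C(I, E))) t

protected lemma Pth.continuous (a : Pth E) : Continuous a := map_continuous a

/-- Constant paths. -/
noncomputable def Pth.const [NormedSpace ℝ E] : E →L[ℝ] Pth E :=
  LinearMap.mkContinuous
    { toFun := fun x => Pth.mk (fun _ => x) continuous_const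
      map_add' := fun _ _ => rfl
      map_smul' := fun _ _ => rfl } 1
    (fun x => by
      rw [Pth.norm_le (by positivity)]
      intro t
      rw [one_mul]
      exact le_rfl)

@[simp] lemma Pth.const_apply [NormedSpace ℝ E] (x : E) (t : I) : Pth.const x t = x := rfl

end Pth

section Nemytskii

variable {E F : Type} [NormedAddCommGroup E] [NormedSpace ℝ E]
  [NormedAddCommGroup F] [NormedSpace ℝ F]

/-- Pointwise application of a path of operators to a path of vectors. -/
noncomputable def applyPath :
    Pth (E →L[ℝ] F) →L[ℝ] (Pth E →L[ℝ] Pth F) :=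
  LinearMap.mkContinuous₂
    (LinearMap.mk₂ ℝ (fun (A : Pth (E →L[ℝ] F)) (h : Pth E) =>
        Pth.mk (fun t => A t (h t)) (A.continuous.clm_apply h.continuous))
      (by intros; ext; simp) (by intros; ext; simp) (by intros; ext; simp)
      (by intros; ext; simp)) 1
    (by
      intro A h
      rw [Pth.norm_le (by positivity)]
      intro t
      rw [one_mul]
      exact (ContinuousLinearMap.le_opNorm _ _).trans
        (mul_le_mul (A.norm_coe_le_norm t) (h.norm_coe_le_norm t) (norm_nonneg _) (norm_nonneg _)))

@[simp] lemma applyPath_apply (A : Pth (E →L[ℝ] F)) (h : Pth E) (t : I) :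
    applyPath A h t = A t (h t) := rfl

/-- Superposition operator. -/
def nem (f : E → F) (hf : Continuous f) (α : Pth E) : Pth F :=
  Pth.mk (fun t => f (α t)) (hf.comp α.continuous)

@[simp] lemma nem_apply (f : E → F) (hf : Continuous f) (α : Pth E) (t : I) :
    nem f hf α t = f (α t) := rfl

lemma continuous_nem (f : E → F) (hf : Continuous f) : Continuous (nem f hf) :=
  ContinuousMap.continuous_postcomp (X := I) (⟨f, hf⟩ : C(E, F))

lemma hasFDerivAt_nem (f : E → F) (hf : Continuous f) (hd : Differentiable ℝ f)
    (hf' : Continuous (fderiv ℝ f)) (α : Pth E) :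
    HasFDerivAt (nem f hf) (applyPath (nem (fderiv ℝ f) hf' α)) α := by
  rw [hasFDerivAt_iff_isLittleO_nhds_zero, Asymptotics.isLittleO_iff]
  intro ε hε
  have hc := (continuous_nem (fderiv ℝ f) hf').continuousAt (x := α)
  rw [Metric.continuousAt_iff] at hc
  obtain ⟨δ, hδ, hδ'⟩ := hc ε hε
  filter_upwards [Metric.ball_mem_nhds (0 : Pth E) hδ] with h hh
  rw [Pth.norm_le (by positivity)]
  intro t
  have hball : ∀ z ∈ Metric.ball (α t) δ, ‖fderiv ℝ f z - fderiv ℝ f (α t)‖ ≤ ε := by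
    intro z hz
    have h1 : dist (α + Pth.const (z - α t)) α < δ := by
      rw [dist_eq_norm, add_sub_cancel_left]
      refine lt_of_le_of_lt ((Pth.norm_le (norm_nonneg (z - α t))).2 fun _ => le_rfl) ?_
      simpa [dist_eq_norm] using hz
    have h2 := (Pth.dist_coe_le_dist _ _ t).trans (hδ' h1).le
    simpa [dist_eq_norm] using h2
  have hmem : α t + h t ∈ Metric.ball (α t) δ := by
    have := h.norm_coe_le_norm t
    simp only [Metric.mem_ball, dist_zero_right] at hh
    simpa [dist_eq_norm] using this.trans_lt hh
  have key := Convex.norm_image_sub_le_of_norm_fderiv_le' (𝕜 := ℝ) (f := f)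
    (fun z _ => hd z) hball (convex_ball _ _) (Metric.mem_ball_self hδ) hmem
  simp only [add_sub_cancel_left] at key
  refine le_trans ?_ (key.trans (mul_le_mul_of_nonneg_left (h.norm_coe_le_norm t) hε.le))
  simp

lemma contDiff_nem_nat (k : ℕ) : ∀ {F : Type} [NormedAddCommGroup F] [NormedSpace ℝ F]
    (f : E → F) (hf : Continuous f), ContDiff ℝ k f → ContDiff ℝ k (nem f hf) := by
  induction k with
  | zero =>
    intro F _ _ f hf _
    exact contDiff_zero.2 (continuous_nem f hf)
  | succ k ih =>
    intro F _ _ f hf h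
    push_cast at h ⊢
    have h' := contDiff_succ_iff_fderiv.1 h
    have hc : Continuous (fderiv ℝ f) := h'.2.2.continuous
    rw [contDiff_succ_iff_hasFDerivAt]
    have h2 : ContDiff ℝ k ((applyPath : Pth (E →L[ℝ] F) →L[ℝ] _) ∘ nem (fderiv ℝ f) hc) :=
      (ContinuousLinearMap.contDiff _).comp (ih _ hc h'.2.2)
    exact ⟨fun α => applyPath (nem (fderiv ℝ f) hc α), h2, fun α => hasFDerivAt_nem f hf h'.1 hc α⟩

lemma contDiff_nem (f : E → F) (hf : Continuous f) (h : ContDiff ℝ ∞ f) :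
    ContDiff ℝ ∞ (nem f hf) :=
  contDiff_infty.2 fun k => contDiff_nem_nat k f hf (contDiff_infty.1 h k)

lemma bdd_nem (i : ℕ) : ∀ {F : Type} [NormedAddCommGroup F] [NormedSpace ℝ F]
    (f : E → F) (hf : Continuous f), ContDiff ℝ ∞ f →
    (∃ K : ℝ, ∀ x, ‖iteratedFDeriv ℝ i f x‖ ≤ K) →
    ∃ K : ℝ, ∀ x, ‖iteratedFDeriv ℝ i (nem f hf) x‖ ≤ K := by
  induction i with
  | zero =>
    intro F _ _ f hf _ ⟨K, hK⟩
    refine ⟨max K 0, fun α => ?_⟩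
    rw [norm_iteratedFDeriv_zero, Pth.norm_le (le_max_right _ _)]
    intro t
    have := hK (α t)
    rw [norm_iteratedFDeriv_zero] at this
    exact this.trans (le_max_left _ _)
  | succ i ih =>
    intro F _ _ f hf h ⟨K, hK⟩
    have h1 : ContDiff ℝ ∞ (fderiv ℝ f) := (contDiff_infty_iff_fderiv.1 h).2
    obtain ⟨K', hK'⟩ := ih (fderiv ℝ f) h1.continuous h1
      ⟨K, fun x => by rw [norm_iteratedFDeriv_fderiv]; exact hK x⟩
    have e : fderiv ℝ (nem f hf) = applyPath ∘ nem (fderiv ℝ f) h1.continuous := by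
      ext1 α
      exact (hasFDerivAt_nem f hf (contDiff_infty_iff_fderiv.1 h).1 h1.continuous α).fderiv
    refine ⟨‖(applyPath : Pth (E →L[ℝ] F) →L[ℝ] _)‖ * K', fun α => ?_⟩
    rw [← norm_iteratedFDeriv_fderiv, e]
    refine (ContinuousLinearMap.norm_iteratedFDeriv_comp_left _
      (contDiff_nem _ h1.continuous h1).contDiffAt (by exact_mod_cast le_top)).trans ?_
    exact mul_le_mul_of_nonneg_left (hK' α) (norm_nonneg _)

lemma Pth.integrable (a : Pth F) : Integrable a (volume : Measure I) :=
  a.continuous.integrable_of_hasCompactSupport (HasCompactSupport.of_compactSpace _)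

/-- Integration over the unit interval. -/
noncomputable def integ : Pth F →L[ℝ] F :=
  LinearMap.mkContinuous
    { toFun := fun β => ∫ u : I, β u
      map_add' := fun a b => by
        simp only [Pth.add_apply]
        exact integral_add a.integrable b.integrable
      map_smul' := fun c a => by
        simp only [Pth.smul_apply, RingHom.id_apply]
        exact integral_smul c _ } 1
    (fun β => by
      have := norm_integral_le_of_norm_le_const (μ := (volume : Measure I)) (f := β) (C := ‖β‖)
        (Filter.Eventually.of_forall fun t => β.norm_coe_le_norm t)
      simpa using this)

lemma integ_apply (β : Pth F) : integ β = ∫ u : I, β u := rfl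

lemma norm_integ_le (β : Pth F) : ‖integ β‖ ≤ ‖β‖ := by
  have := norm_integral_le_of_norm_le_const (μ := (volume : Measure I)) (f := β) (C := ‖β‖)
        (Filter.Eventually.of_forall fun t => β.norm_coe_le_norm t)
  rw [integ_apply]
  simpa using this

lemma integ_eq_interval (β : Pth F) (f : ℝ → F) (h : ∀ t : I, β t = f t) :
    integ β = ∫ t in (0 : ℝ)..1, f t := by
  rw [integ_apply, intervalIntegral.integral_of_le zero_le_one, ← integral_Icc_eq_integral_Ioc,
    ← integral_subtype measurableSet_Icc]
  simp_rw [h]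

/-- Slowing a path down by the factor `τ`. -/
def rescale (τ : I) (β : Pth F) : Pth F :=
  Pth.mk (fun u => β (τ * u)) (β.continuous.comp (continuous_const.mul continuous_id))

@[simp] lemma rescale_apply (τ : I) (β : Pth F) (t : I) : rescale τ β t = β (τ * t) := rfl

lemma continuous_rescale (β : Pth F) : Continuous fun τ : I => rescale τ β :=
  ContinuousMap.continuous_of_continuous_uncurry (Y := I) (Z := F) (X := I)
    (fun τ => (rescale τ β : C(I, F)))
    (β.continuous.comp (continuous_fst.mul continuous_snd))

/-- `V β t = t ∫₀¹ β (t u) du`. -/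
noncomputable def volt : Pth F →L[ℝ] Pth F :=
  LinearMap.mkContinuous
    { toFun := fun β => Pth.mk (fun t => (t : ℝ) • integ (rescale t β))
        (continuous_subtype_val.smul (integ.continuous.comp (continuous_rescale β)))
      map_add' := fun a b => by
        ext t
        have : rescale t (a + b) = rescale t a + rescale t b := rfl
        simp [this]
      map_smul' := fun c a => by
        ext t
        have : rescale t (c • a) = c • rescale t a := rfl
        simp only [this, map_smul, RingHom.id_apply, Pth.mk_apply, Pth.smul_apply]
        exact smul_comm _ _ _ } 1
    (fun β => by
      rw [Pth.norm_le (by positivity)]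
      intro t
      simp only [LinearMap.coe_mk, AddHom.coe_mk, Pth.mk_apply, norm_smul]
      have h1 : ‖(t : ℝ)‖ ≤ 1 := by
        rw [Real.norm_eq_abs, abs_of_nonneg t.2.1]; exact t.2.2
      refine mul_le_mul h1 ((norm_integ_le _).trans ?_) (norm_nonneg _) zero_le_one
      rw [Pth.norm_le (by positivity)]
      intro u
      exact β.norm_coe_le_norm _)

lemma volt_apply (β : Pth F) (t : I) : volt β t = (t : ℝ) • integ (rescale t β) := rfl

end Nemytskii

section Flow

variable {E : Type} [NormedAddCommGroup E] [NormedSpace ℝ E]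

/-- The map whose zero set in the last variable encodes the integral equation. -/
noncomputable def flowMap (ν : E → E) (hc : Continuous ν) (a : (E × ℝ) × Pth E) :
    (E × ℝ) × Pth E :=
  (a.1, a.2 - Pth.const a.1.1 - a.1.2 • volt (nem ν hc a.2))

lemma contDiff_flowMap (ν : E → E) (hc : Continuous ν) (hν : ContDiff ℝ ∞ ν) :
    ContDiff ℝ ∞ (flowMap ν hc) := by
  have h1 : ContDiff ℝ ∞ (fun a : (E × ℝ) × Pth E => volt (nem ν hc a.2)) :=
    volt.contDiff.comp ((contDiff_nem ν hc hν).comp contDiff_snd)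
  have h2 : ContDiff ℝ ∞ (fun a : (E × ℝ) × Pth E => Pth.const a.1.1) :=
    Pth.const.contDiff.comp (contDiff_fst.comp contDiff_fst)
  unfold flowMap
  exact contDiff_fst.prodMk ((contDiff_snd.sub h2).sub ((contDiff_snd.comp contDiff_fst).smul h1))

lemma flowMap_deriv (ν : E → E) (hc : Continuous ν) (hν : ContDiff ℝ ∞ ν) (x₀ : E) :
    ∃ e : ((E × ℝ) × Pth E) ≃L[ℝ] ((E × ℝ) × Pth E),
      HasFDerivAt (flowMap ν hc) (e : ((E × ℝ) × Pth E) →L[ℝ] ((E × ℝ) × Pth E))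
        ((x₀, 0), Pth.const x₀) := by
  have h1 : ContDiff ℝ ∞ (fun a : (E × ℝ) × Pth E => volt (nem ν hc a.2)) :=
    volt.contDiff.comp ((contDiff_nem ν hc hν).comp contDiff_snd)
  have d1 := ((h1.differentiable (by simp)) ((x₀, 0), Pth.const x₀)).hasFDerivAt
  have d2 : HasFDerivAt (fun a : (E × ℝ) × Pth E => a.1.2)
      ((ContinuousLinearMap.snd ℝ E ℝ).comp (ContinuousLinearMap.fst ℝ (E × ℝ) (Pth E)))
      ((x₀, 0), Pth.const x₀) :=
    ((ContinuousLinearMap.snd ℝ E ℝ).comp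
      (ContinuousLinearMap.fst ℝ (E × ℝ) (Pth E))).hasFDerivAt
  have d3 : HasFDerivAt (fun a : (E × ℝ) × Pth E => Pth.const a.1.1)
      (Pth.const.comp ((ContinuousLinearMap.fst ℝ E ℝ).comp
        (ContinuousLinearMap.fst ℝ (E × ℝ) (Pth E))))
      ((x₀, 0), Pth.const x₀) :=
    (Pth.const.comp ((ContinuousLinearMap.fst ℝ E ℝ).comp
        (ContinuousLinearMap.fst ℝ (E × ℝ) (Pth E)))).hasFDerivAt
  have d := (hasFDerivAt_fst (𝕜 := ℝ) (p := (((x₀, 0), Pth.const x₀) : (E × ℝ) × Pth E))).prodMk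
    (((hasFDerivAt_snd (𝕜 := ℝ) (p := (((x₀, 0), Pth.const x₀) : (E × ℝ) × Pth E))).sub d3).sub
      (d2.smul d1))
  refine ⟨ContinuousLinearEquiv.skewProd (ContinuousLinearEquiv.refl ℝ (E × ℝ))
    (ContinuousLinearEquiv.refl ℝ (Pth E))
    (-(Pth.const.comp (ContinuousLinearMap.fst ℝ E ℝ)
      + (ContinuousLinearMap.snd ℝ E ℝ).smulRight (volt (nem ν hc (Pth.const x₀))))), ?_⟩
  refine HasFDerivAt.congr_fderiv (f := flowMap ν hc) d ?_
  refine ContinuousLinearMap.ext fun a => ?_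
  refine Prod.ext ?_ ?_
  · simp [ContinuousLinearEquiv.skewProd]
  · simp [ContinuousLinearEquiv.skewProd]
    abel

lemma local_flow [CompleteSpace E] (ν : E → E) (hν : ContDiff ℝ ∞ ν) (x₀ : E) :
    ∃ ϕ : E × ℝ → E, ∀ᶠ p in 𝓝 ((x₀, 0) : E × ℝ), ContDiffAt ℝ ∞ ϕ p ∧
      HasDerivAt (fun s => ϕ (p.1, s)) (ν (ϕ p)) p.2 ∧ ϕ (p.1, 0) = p.1 := by
  have hc := hν.continuous
  obtain ⟨e, he⟩ := flowMap_deriv ν hc hν x₀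
  have hG := contDiff_flowMap ν hc hν
  set a₀ : (E × ℝ) × Pth E := ((x₀, 0), Pth.const x₀) with ha₀
  let G := hG.contDiffAt.toOpenPartialHomeomorph (flowMap ν hc) he (by simp)
  have hGcoe : (G : (E × ℝ) × Pth E → (E × ℝ) × Pth E) = flowMap ν hc := rfl
  have hsrc : a₀ ∈ G.source := hG.contDiffAt.mem_toOpenPartialHomeomorph_source he (by simp)
  have hGa : G a₀ = ((x₀, 0), 0) := by
    rw [hGcoe]; simp [flowMap, ha₀]
  let ι : E × ℝ → (E × ℝ) × Pth E := fun p => (p, 0)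
  have hι : Continuous ι := by fun_prop
  have hιs : ContDiff ℝ ∞ ι := contDiff_id.prodMk contDiff_const
  have hι0 : ι (x₀, 0) = G a₀ := hGa.symm
  have htgt : ∀ᶠ p in 𝓝 ((x₀, 0) : E × ℝ), ι p ∈ G.target :=
    hι.continuousAt.eventually_mem (by
      rw [hι0]; exact G.open_target.mem_nhds (G.map_source hsrc))
  have hsymm0 : G.symm (ι (x₀, 0)) = a₀ := by rw [hι0]; exact G.left_inv hsrc
  have hsc : ContinuousAt (fun p => G.symm (ι p)) ((x₀, 0) : E × ℝ) := by
    refine ContinuousAt.comp (g := G.symm) ?_ hι.continuousAt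
    rw [hι0]; exact G.continuousAt_symm (G.map_source hsrc)
  -- smoothness near the base point
  have hsm : ∀ᶠ p in 𝓝 ((x₀, 0) : E × ℝ), ContDiffAt ℝ ∞ (fun p => G.symm (ι p)) p := by
    have hop : ∀ᶠ a in 𝓝 a₀, fderiv ℝ (flowMap ν hc) a ∈ Set.range
        (ContinuousLinearEquiv.toContinuousLinearMap :
          (((E × ℝ) × Pth E) ≃L[ℝ] ((E × ℝ) × Pth E)) → _) := by
      refine (hG.continuous_fderiv (by simp)).continuousAt.eventually_mem ?_
      refine (ContinuousLinearEquiv.isOpen).mem_nhds ?_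
      rw [he.fderiv]; exact ⟨e, rfl⟩
    have hop' := hsc.tendsto.eventually (by rw [hsymm0]; exact hop)
    filter_upwards [htgt, hop'] with p hp ⟨e', he'⟩
    have : HasFDerivAt G (e' : ((E × ℝ) × Pth E) →L[ℝ] ((E × ℝ) × Pth E)) (G.symm (ι p)) := by
      rw [he']
      exact (hG.differentiable (by simp) _).hasFDerivAt
    exact (G.contDiffAt_symm hp this hG.contDiffAt).comp p hιs.contDiffAt
  let α : E × ℝ → Pth E := fun p => (G.symm (ι p)).2
  have hα0 : α (x₀, 0) = Pth.const x₀ := by simp only [α, hsymm0, ha₀]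
  have hαsm : ∀ᶠ p in 𝓝 ((x₀, 0) : E × ℝ), ContDiffAt ℝ ∞ α p := by
    filter_upwards [hsm] with p hp
    exact contDiff_snd.contDiffAt.comp p hp
  have hαc : ContinuousAt α (x₀, 0) := hαsm.self_of_nhds.continuousAt
  -- the integral equation
  have hfix : ∀ p, ι p ∈ G.target → α p = Pth.const p.1 + p.2 • volt (nem ν hc (α p)) := by
    intro p hp
    have h1 : flowMap ν hc (G.symm (ι p)) = (p, 0) := G.right_inv hp
    have h2 : (G.symm (ι p)).1 = p := by
      have := congrArg Prod.fst h1
      exact this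
    have h3 := congrArg Prod.snd h1
    simp only [flowMap, h2] at h3
    rw [sub_sub, sub_eq_zero] at h3
    exact h3
  -- local uniqueness
  have huniq : ∀ p β, (p, β) ∈ G.source → β = Pth.const p.1 + p.2 • volt (nem ν hc β) →
      β = α p := by
    intro p β hs hb
    have h1 : G (p, β) = ι p := by
      rw [hGcoe]
      simp only [flowMap, ι]
      rw [sub_sub, ← hb, sub_self]
    have : G.symm (ι p) = (p, β) := by rw [← h1]; exact G.left_inv hs
    simp only [α, this]
  obtain ⟨δ, hδ, hball⟩ := Metric.isOpen_iff.1 G.open_source a₀ hsrc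
  have hall : ∀ᶠ p in 𝓝 ((x₀, 0) : E × ℝ), ContDiffAt ℝ ∞ α p ∧ ι p ∈ G.target ∧
      dist (α p) (Pth.const x₀) < δ := by
    refine hαsm.and (htgt.and ?_)
    have := hαc.eventually (Metric.ball_mem_nhds (α (x₀, 0)) hδ)
    rw [hα0] at this
    exact this
  obtain ⟨ε, hε, hεb⟩ := Metric.eventually_nhds_iff_ball.1 hall
  let ρ := min ε δ
  have hρ : 0 < ρ := lt_min hε hδ
  -- scaling of time
  have hscale : ∀ x s, (x, s) ∈ Metric.ball ((x₀, 0) : E × ℝ) ρ → ∀ τ : I,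
      α (x, (τ : ℝ) * s) = rescale τ (α (x, s)) := by
    intro x s hxs τ
    obtain ⟨-, htg, hd⟩ := hεb (x, s) (Metric.ball_subset_ball (min_le_left _ _) hxs)
    have hxs' := Metric.ball_subset_ball (min_le_right ε δ) hxs
    symm
    apply huniq
    · apply hball
      rw [Metric.mem_ball, Prod.dist_eq, max_lt_iff, Prod.dist_eq, max_lt_iff] at *
      simp only [ha₀] at *
      refine ⟨⟨hxs'.1, ?_⟩, ?_⟩
      · refine lt_of_le_of_lt ?_ hxs'.2
        simp only [dist_zero_right, norm_mul]
        have : ‖(τ : ℝ)‖ ≤ 1 := by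
          rw [Real.norm_eq_abs, abs_of_nonneg τ.2.1]; exact τ.2.2
        exact mul_le_of_le_one_left (norm_nonneg _) this
      · refine lt_of_le_of_lt ?_ hd
        rw [dist_eq_norm, Pth.norm_le dist_nonneg]
        intro t
        have := Pth.dist_coe_le_dist (α (x, s)) (Pth.const x₀) (τ * t)
        rw [dist_eq_norm] at this
        simpa using this
    · ext t
      have h := congrArg (fun β : Pth E => β (τ * t)) (hfix _ htg)
      simp only [Pth.add_apply, Pth.const_apply, Pth.smul_apply, volt_apply] at h ⊢
      rw [rescale_apply, h]
      have hr : rescale (τ * t) (nem ν hc (α (x, s)))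
          = rescale t (nem ν hc (rescale τ (α (x, s)))) := by
        ext u
        simp [mul_assoc]
      rw [hr, smul_smul, smul_smul]
      congr 2
      push_cast
      ring
  let ϕ : E × ℝ → E := fun p => α p 1
  let ev : Pth E →L[ℝ] E := LinearMap.mkContinuous
    { toFun := fun β => β 1
      map_add' := fun _ _ => rfl
      map_smul' := fun _ _ => rfl } 1 (fun β => by rw [one_mul]; exact β.norm_coe_le_norm 1)
  have hϕ : ∀ x s, (x, s) ∈ Metric.ball ((x₀, 0) : E × ℝ) ρ → ∀ τ : I,
      ϕ (x, (τ : ℝ) * s) = α (x, s) τ := by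
    intro x s h τ
    simp only [ϕ, hscale x s h τ, rescale_apply, mul_one]
  have hint : ∀ x s, (x, s) ∈ Metric.ball ((x₀, 0) : E × ℝ) ρ →
      ϕ (x, s) = x + ∫ w in (0 : ℝ)..s, ν (ϕ (x, w)) := by
    intro x s h
    obtain ⟨-, htg, hd⟩ := hεb (x, s) (Metric.ball_subset_ball (min_le_left _ _) h)
    have h1 := congrArg (fun β : Pth E => β 1) (hfix _ htg)
    simp only [Pth.add_apply, Pth.const_apply, Pth.smul_apply, volt_apply] at h1
    simp only [ϕ]
    rw [h1]
    congr 1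
    rw [integ_eq_interval _ (fun t => ν (ϕ (x, s * t)))]
    · have := intervalIntegral.smul_integral_comp_mul_left (a := 0) (b := 1)
        (fun w => ν (ϕ (x, w))) s
      simpa [ϕ] using this
    · intro t
      have := hϕ x s h t
      rw [mul_comm] at this
      simp [this]
  have hϕs : ∀ p ∈ Metric.ball ((x₀, 0) : E × ℝ) ρ, ContDiffAt ℝ ∞ ϕ p := by
    intro p hp
    obtain ⟨hs, -, -⟩ := hεb p (Metric.ball_subset_ball (min_le_left _ _) hp)
    exact ev.contDiff.contDiffAt.comp p hs
  refine ⟨ϕ, ?_⟩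
  filter_upwards [Metric.ball_mem_nhds _ hρ] with p hp
  obtain ⟨x, s⟩ := p
  have hbx : ∀ s', |s'| < ρ ↔ (x, s') ∈ Metric.ball ((x₀, 0) : E × ℝ) ρ := by
    intro s'
    rw [Metric.mem_ball, Prod.dist_eq, max_lt_iff] at hp ⊢
    simp only [dist_zero_right, Real.norm_eq_abs] at hp ⊢
    exact ⟨fun h => ⟨hp.1, h⟩, fun h => h.2⟩
  have hcont : ∀ s', |s'| < ρ → ContinuousAt (fun w => ν (ϕ (x, w))) s' := by
    intro s' h
    have h1 : ContinuousAt ϕ (x, s') := (hϕs _ ((hbx s').1 h)).continuousAt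
    exact hc.continuousAt.comp (ContinuousAt.comp (f := fun w => (x, w)) h1 (by fun_prop))
  have hs : |s| < ρ := (hbx s).2 hp
  refine ⟨hϕs _ hp, ?_, ?_⟩
  · have hopen : IsOpen {w : ℝ | |w| < ρ} := isOpen_lt continuous_abs continuous_const
    have hco : ContinuousOn (fun w => ν (ϕ (x, w))) {w : ℝ | |w| < ρ} :=
      fun w hw => (hcont w hw).continuousWithinAt
    have hd : HasDerivAt (fun s => ∫ w in (0 : ℝ)..s, ν (ϕ (x, w))) (ν (ϕ (x, s))) s := by
      refine intervalIntegral.integral_hasDerivAt_right ?_ ?_ (hcont s hs)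
      · refine ContinuousOn.intervalIntegrable (hco.mono ?_)
        intro w hw
        rw [Set.mem_uIcc] at hw
        rw [abs_lt] at hs
        rw [Set.mem_ofPred_eq, abs_lt]
        rcases hw with h | h <;> constructor <;> linarith [h.1, h.2]
      · exact hco.stronglyMeasurableAtFilter hopen s hs
    refine (hd.const_add x).congr_of_eventuallyEq ?_
    filter_upwards [hopen.mem_nhds hs] with w hw
    exact hint x w ((hbx w).1 hw)
  · have := hint x 0 ((hbx 0).1 (by simpa using hρ))
    simpa using this

end Flow

section Bdd

/-- Smooth with all derivatives (including order zero) bounded. -/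
def BD {D F : Type} [NormedAddCommGroup D] [NormedSpace ℝ D] [NormedAddCommGroup F]
    [NormedSpace ℝ F] (f : D → F) : Prop :=
  ContDiff ℝ ∞ f ∧ ∀ i : ℕ, ∃ K : ℝ, ∀ x, ‖iteratedFDeriv ℝ i f x‖ ≤ K

variable {D F G : Type} [NormedAddCommGroup D] [NormedSpace ℝ D] [NormedAddCommGroup F]
    [NormedSpace ℝ F] [NormedAddCommGroup G] [NormedSpace ℝ G]

lemma BD.of_hasCompactSupport {f : D → F} (hf : ContDiff ℝ ∞ f) (hs : HasCompactSupport f) :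
    BD f := by
  refine ⟨hf, fun i => ?_⟩
  obtain ⟨C, hC⟩ := (hs.iteratedFDeriv (𝕜 := ℝ) i).exists_bound_of_continuous
    (hf.continuous_iteratedFDeriv (m := i) (by exact_mod_cast le_top))
  exact ⟨C, hC⟩

lemma BD.comp_compact {f : D → F} (hf : BD f) {K U : Set F} (hK : IsCompact K) (hU : IsOpen U)
    (hKU : K ⊆ U) (hfK : ∀ x, f x ∈ K) {g : F → G} (hg : ContDiffOn ℝ ∞ g U) :
    BD (fun x => g (f x)) := by
  have hgf : ContDiff ℝ ∞ (g ∘ f) := by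
    rw [← contDiffOn_univ]
    exact hg.comp hf.1.contDiffOn fun x _ => hKU (hfK x)
  refine ⟨hgf, fun i => ?_⟩
  have h1 : ∀ j : ℕ, ∃ C : ℝ, ∀ y ∈ K, ‖iteratedFDerivWithin ℝ j g U y‖ ≤ C := fun j =>
    hK.exists_bound_of_continuousOn
      ((hg.continuousOn_iteratedFDerivWithin (m := j) (by exact_mod_cast le_top)
        hU.uniqueDiffOn).mono hKU)
  choose C hC using h1
  choose L hL using hf.2
  refine ⟨(i.factorial : ℝ) * (∑ j ∈ Finset.range (i + 1), |C j|) *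
    (1 + ∑ j ∈ Finset.range (i + 1), |L j|) ^ i, fun x => ?_⟩
  have := norm_iteratedFDerivWithin_comp_le (n := i) (x := x) hg hf.1.contDiffOn
    (by exact_mod_cast le_top) hU.uniqueDiffOn uniqueDiffOn_univ (fun x _ => hKU (hfK x))
    (Set.mem_univ x) (C := ∑ j ∈ Finset.range (i + 1), |C j|)
    (D := 1 + ∑ j ∈ Finset.range (i + 1), |L j|) ?_ ?_
  · rw [iteratedFDerivWithin_univ] at this
    exact this
  · intro j hj
    refine ((hC j _ (hfK x)).trans (le_abs_self _)).trans ?_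
    exact Finset.single_le_sum (f := fun j => |C j|) (fun _ _ => abs_nonneg _)
      (Finset.mem_range.2 (by omega))
  · intro j hj1 hj
    rw [iteratedFDerivWithin_univ]
    refine ((hL j x).trans (le_abs_self _)).trans ?_
    have h2 : |L j| ≤ ∑ j ∈ Finset.range (i + 1), |L j| :=
      Finset.single_le_sum (f := fun j => |L j|) (fun _ _ => abs_nonneg _)
        (Finset.mem_range.2 (by omega))
    have h3 : 0 ≤ ∑ j ∈ Finset.range (i + 1), |L j| := Finset.sum_nonneg fun _ _ => abs_nonneg _
    have h4 : (1 : ℝ) ≤ 1 + ∑ j ∈ Finset.range (i + 1), |L j| := by linarith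
    exact le_trans (by linarith) (le_self_pow₀ h4 (by omega))

lemma BD.clm_comp {f : D → F} (hf : BD f) (L : F →L[ℝ] G) : BD (fun x => L (f x)) := by
  refine ⟨L.contDiff.comp hf.1, fun i => ?_⟩
  obtain ⟨K, hK⟩ := hf.2 i
  refine ⟨‖L‖ * K, fun x => ?_⟩
  exact (ContinuousLinearMap.norm_iteratedFDeriv_comp_left L hf.1.contDiffAt
    (by exact_mod_cast le_top)).trans (mul_le_mul_of_nonneg_left (hK x) (norm_nonneg _))

lemma BD.comp_clm {f : F → G} (hf : BD f) (L : D →L[ℝ] F) : BD (fun x => f (L x)) := by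
  refine ⟨hf.1.comp L.contDiff, fun i => ?_⟩
  obtain ⟨K, hK⟩ := hf.2 i
  refine ⟨K * ∏ _j : Fin i, ‖L‖, fun x => ?_⟩
  have := ContinuousLinearMap.iteratedFDeriv_comp_right L hf.1 x (i := i)
    (by exact_mod_cast le_top)
  change ‖iteratedFDeriv ℝ i (f ∘ L) x‖ ≤ _
  rw [this]
  refine (ContinuousMultilinearMap.norm_compContinuousLinearMap_le _ _).trans ?_
  exact mul_le_mul_of_nonneg_right (hK _) (Finset.prod_nonneg fun _ _ => norm_nonneg _)

lemma BD.nem {f : D → F} (hf : BD f) : BD (nem f hf.1.continuous) :=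
  ⟨contDiff_nem f _ hf.1, fun i => bdd_nem i f _ hf.1 (hf.2 i)⟩

lemma BD.bdd_of_fderiv {f : D → F} (hf : BD (fderiv ℝ f)) (i : ℕ) (hi : 1 ≤ i) :
    ∃ K : ℝ, ∀ x, ‖iteratedFDeriv ℝ i f x‖ ≤ K := by
  obtain ⟨j, rfl⟩ : ∃ j, i = j + 1 := ⟨i - 1, by omega⟩
  obtain ⟨K, hK⟩ := hf.2 j
  exact ⟨K, fun x => by rw [← norm_iteratedFDeriv_fderiv]; exact hK x⟩

end Bdd

section Cutoff

variable {E F : Type} [NormedAddCommGroup E] [InnerProductSpace ℝ E] [FiniteDimensional ℝ E]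
  [NormedAddCommGroup F] [NormedSpace ℝ F]

lemma exists_cutoff (k : E → F) (hk : ∀ᶠ x in 𝓝 (0 : E), ContDiffAt ℝ ∞ k x) (h0 : k 0 = 0)
    (hd0 : fderiv ℝ k 0 = 0) :
    ∃ g : E → F, ContDiff ℝ ∞ g ∧ HasCompactSupport g ∧ (∀ x, ‖fderiv ℝ g x‖ ≤ 1 / 2) ∧
      ∃ δ > 0, ∀ x ∈ Metric.ball (0 : E) δ, g x = k x := by
  let χ : ContDiffBump (0 : E) := ⟨1, 2, one_pos, one_lt_two⟩
  have hχs : ContDiff ℝ ∞ χ := χ.contDiff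
  obtain ⟨M₀, hM₀⟩ := (BD.of_hasCompactSupport hχs χ.hasCompactSupport).2 1
  have hM₀' : ∀ x, ‖fderiv ℝ χ x‖ ≤ M₀ := fun x => by
    have := hM₀ x
    rwa [← norm_iteratedFDeriv_fderiv, norm_iteratedFDeriv_zero] at this
  have hMn : 0 ≤ M₀ := (norm_nonneg _).trans (hM₀' 0)
  let ε : ℝ := 1 / (2 * (2 * M₀ + 1))
  have hε : 0 < ε := by positivity
  have hcd : ContinuousAt (fderiv ℝ k) 0 :=
    (hk.self_of_nhds.fderiv_right (m := 0) (by simp)).continuousAt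
  have hev : ∀ᶠ x in 𝓝 (0 : E), ContDiffAt ℝ ∞ k x ∧ ‖fderiv ℝ k x‖ ≤ ε := by
    refine hk.and ?_
    have hlt : ‖fderiv ℝ k 0‖ < ε := by rw [hd0, norm_zero]; exact hε
    have := hcd.norm.tendsto.eventually (Iio_mem_nhds hlt)
    exact this.mono fun x hx => le_of_lt hx
  obtain ⟨ρ, hρ, hρb⟩ := Metric.eventually_nhds_iff_ball.1 hev
  let δ := ρ / 3
  have hδ : 0 < δ := by positivity
  let g : E → F := fun x => χ (δ⁻¹ • x) • k x
  have hin : ∀ x : E, ‖x‖ ≤ 2 * δ → x ∈ Metric.ball (0 : E) ρ := by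
    intro x hx
    rw [mem_ball_zero_iff]
    refine lt_of_le_of_lt hx ?_
    simp only [δ]; linarith
  have hχ0 : ∀ x : E, 2 * δ ≤ ‖x‖ → χ (δ⁻¹ • x) = 0 := by
    intro x hx
    apply χ.zero_of_le_dist
    rw [dist_zero_right, norm_smul, norm_inv, Real.norm_of_nonneg hδ.le]
    change (2 : ℝ) ≤ _
    rw [inv_mul_eq_div, le_div_iff₀ hδ]
    exact hx
  have hout : ∀ x : E, 2 * δ < ‖x‖ → g =ᶠ[𝓝 x] fun _ => 0 := by
    intro x hx
    filter_upwards [(isOpen_lt continuous_const continuous_norm).mem_nhds hx] with y hy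
    simp only [g, hχ0 y (le_of_lt hy), zero_smul]
  have hχδ : ContDiff ℝ ∞ fun x : E => χ (δ⁻¹ • x) := hχs.comp (contDiff_const_smul _)
  refine ⟨g, ?_, ?_, ?_, δ, hδ, ?_⟩
  · rw [contDiff_iff_contDiffAt]
    intro x
    by_cases hx : ‖x‖ ≤ 2 * δ
    · exact hχδ.contDiffAt.smul (hρb x (hin x hx)).1
    · exact contDiffAt_const.congr_of_eventuallyEq (hout x (not_le.1 hx))
  · refine HasCompactSupport.intro (isCompact_closedBall (0 : E) (2 * δ)) ?_
    intro x hx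
    rw [mem_closedBall_zero_iff, not_le] at hx
    simp only [g, hχ0 x hx.le, zero_smul]
  · intro x
    by_cases hx : ‖x‖ ≤ 2 * δ
    · have hkx : ‖k x‖ ≤ ε * (2 * δ) := by
        have := (convex_ball (0 : E) ρ).norm_image_sub_le_of_norm_fderiv_le (𝕜 := ℝ) (f := k)
          (fun y hy => (hρb y hy).1.differentiableAt (by simp)) (fun y hy => (hρb y hy).2)
          (Metric.mem_ball_self hρ) (hin x hx)
        rw [h0, sub_zero, sub_zero] at this
        exact this.trans (mul_le_mul_of_nonneg_left hx hε.le)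
      have d1 : HasFDerivAt (fun x : E => χ (δ⁻¹ • x)) (δ⁻¹ • fderiv ℝ χ (δ⁻¹ • x)) x := by
        have a := (hχs.differentiable (by simp) (δ⁻¹ • x)).hasFDerivAt
        have b : HasFDerivAt (fun x : E => δ⁻¹ • x) (δ⁻¹ • ContinuousLinearMap.id ℝ E) x :=
          (hasFDerivAt_id x).const_smul δ⁻¹
        refine (a.comp x b).congr_fderiv ?_
        ext v
        simp
      have d2 := ((hρb x (hin x hx)).1.differentiableAt (by simp)).hasFDerivAt
      have d3 : HasFDerivAt g _ x := d1.smul d2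
      rw [d3.fderiv]
      refine (norm_add_le _ _).trans ?_
      rw [norm_smul, ContinuousLinearMap.norm_smulRight_apply, norm_smul, norm_inv,
        Real.norm_of_nonneg hδ.le, Real.norm_of_nonneg χ.nonneg]
      have e1 : χ (δ⁻¹ • x) * ‖fderiv ℝ k x‖ ≤ 1 * ε :=
        mul_le_mul χ.le_one (hρb x (hin x hx)).2 (norm_nonneg _) zero_le_one
      have e2 : δ⁻¹ * ‖fderiv ℝ χ (δ⁻¹ • x)‖ * ‖k x‖ ≤ δ⁻¹ * M₀ * (ε * (2 * δ)) := by
        gcongr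
        exact hM₀' _
      have e3 : δ⁻¹ * M₀ * (ε * (2 * δ)) = 2 * M₀ * ε := by
        field_simp
      have e4 : (2 * M₀ + 1) * ε = 1 / 2 := by
        simp only [ε]; field_simp
      linarith
    · rw [(hout x (not_le.1 hx)).fderiv_eq]
      simp
  · intro x hx
    have : χ (δ⁻¹ • x) = 1 := by
      apply χ.one_of_mem_closedBall
      rw [mem_closedBall_zero_iff, norm_smul, norm_inv, Real.norm_of_nonneg hδ.le]
      rw [mem_ball_zero_iff] at hx
      change _ ≤ (1 : ℝ)
      rw [inv_mul_eq_div, div_le_one hδ]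
      exact hx.le
    simp only [g, this, one_smul]

end Cutoff

section Global

variable {D F G : Type} [NormedAddCommGroup D] [NormedSpace ℝ D] [NormedAddCommGroup F]
    [NormedSpace ℝ F] [NormedAddCommGroup G] [NormedSpace ℝ G]

lemma BD.add {f g : D → F} (hf : BD f) (hg : BD g) : BD (fun x => f x + g x) := by
  refine ⟨hf.1.add hg.1, fun i => ?_⟩
  obtain ⟨K, hK⟩ := hf.2 i
  obtain ⟨L, hL⟩ := hg.2 i
  refine ⟨K + L, fun x => ?_⟩
  have h1 : ContDiffAt ℝ i f x := (hf.1.of_le (by exact_mod_cast le_top)).contDiffAt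
  have h2 : ContDiffAt ℝ i g x := (hg.1.of_le (by exact_mod_cast le_top)).contDiffAt
  have : iteratedFDeriv ℝ i (fun x => f x + g x) x
      = iteratedFDeriv ℝ i f x + iteratedFDeriv ℝ i g x := iteratedFDeriv_add_apply h1 h2
  rw [this]
  exact (norm_add_le _ _).trans (add_le_add (hK x) (hL x))

lemma BD.const (c : F) : BD (fun _ : D => c) := by
  refine ⟨contDiff_const, fun i => ?_⟩
  rcases Nat.eq_zero_or_pos i with rfl | hi
  · exact ⟨‖c‖, fun x => by rw [norm_iteratedFDeriv_zero]⟩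
  · refine ⟨0, fun x => ?_⟩
    rw [iteratedFDeriv_const_of_ne (by omega)]
    simp

variable {E : Type} [NormedAddCommGroup E] [InnerProductSpace ℝ E] [FiniteDimensional ℝ E]

lemma perturb (g : E → E) (hg : ContDiff ℝ ∞ g) (hb : ∀ x, ‖fderiv ℝ g x‖ ≤ 1 / 2) :
    ∃ Θ : E ≃ₜ E, ∀ y, Θ y = y + g y := by
  have hl : ∀ x y, ‖g x - g y‖ ≤ 1 / 2 * ‖x - y‖ := fun x y =>
    (convex_univ (𝕜 := ℝ) (E := E)).norm_image_sub_le_of_norm_fderiv_le (𝕜 := ℝ)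
      (fun z _ => hg.differentiable (by simp) z) (fun z _ => hb z) (Set.mem_univ y)
      (Set.mem_univ x)
  have ha : ApproximatesLinearOn (fun y => y + g y)
      ((ContinuousLinearEquiv.refl ℝ E : E ≃L[ℝ] E) : E →L[ℝ] E) Set.univ (1 / 2) := by
    intro x _ y _
    have : x + g x - (y + g y) - (ContinuousLinearEquiv.refl ℝ E : E →L[ℝ] E) (x - y)
        = g x - g y := by
      simp
      abel
    rw [this]
    simpa using hl x y
  refine ⟨ha.toHomeomorph _ ?_, fun y => rfl⟩
  rcases subsingleton_or_nontrivial E with h | h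
  · exact Or.inl h
  · right
    have : ‖((ContinuousLinearEquiv.refl ℝ E).symm : E →L[ℝ] E)‖₊ = 1 := by
      ext
      exact ContinuousLinearMap.norm_id
    rw [this, ← NNReal.coe_lt_coe]
    norm_num

lemma isUnit_one_add {R : E →L[ℝ] E} (hR : ‖R‖ ≤ 1 / 2) : IsUnit (1 + R) := by
  have := isUnit_one_sub_of_norm_lt_one (x := -R) (by rw [norm_neg]; linarith)
  rwa [sub_neg_eq_add] at this

lemma perturb_smooth (g : E → E) (hg : ContDiff ℝ ∞ g) (hb : ∀ x, ‖fderiv ℝ g x‖ ≤ 1 / 2)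
    (Θ : E ≃ₜ E) (hΘ : ∀ y, Θ y = y + g y) : ContDiff ℝ ∞ Θ.symm := by
  have hfun : (Θ : E → E) = fun y => y + g y := funext hΘ
  refine Θ.contDiff_symm (f₀' := fun a =>
    ContinuousLinearEquiv.unitsEquiv ℝ E (isUnit_one_add (hb a)).unit) ?_ ?_
  · intro a
    rw [hfun]
    exact (hasFDerivAt_id a).add (hg.differentiable (by simp) a).hasFDerivAt
  · rw [hfun]
    exact contDiff_id.add hg

/-- The segment map. -/
noncomputable def seg : E × E →L[ℝ] Pth E :=
  Pth.const.comp (ContinuousLinearMap.fst ℝ E E) +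
    volt.comp (Pth.const.comp (ContinuousLinearMap.snd ℝ E E - ContinuousLinearMap.fst ℝ E E))

lemma seg_apply (p : E × E) (t : I) : seg p t = p.1 + (t : ℝ) • (p.2 - p.1) := by
  have h : integ (rescale t (Pth.const (p.2 - p.1))) = p.2 - p.1 := by
    rw [integ_eq_interval _ (fun _ => p.2 - p.1) (fun _ => rfl)]
    simp
  have h2 : seg p t = p.1 + volt (Pth.const (p.2 - p.1)) t := rfl
  rw [h2, volt_apply, h]

/-- The averaged derivative of the perturbation. -/
noncomputable def avg (g : E → E) (hg : BD (fderiv ℝ g)) (p : E × E) : E →L[ℝ] E :=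
  integ (nem (fderiv ℝ g) hg.1.continuous (seg p))

lemma avg_eq (g : E → E) (hg : BD (fderiv ℝ g)) (x y : E) :
    avg g hg (x, y) = ∫ t in (0 : ℝ)..1, fderiv ℝ g (x + t • (y - x)) := by
  refine integ_eq_interval _ _ fun t => ?_
  have : nem (fderiv ℝ g) hg.1.continuous (seg (x, y)) t = fderiv ℝ g (seg (x, y) t) := rfl
  rw [this, seg_apply]

lemma avg_BD (g : E → E) (hg : BD (fderiv ℝ g)) : BD (avg g hg) :=
  (hg.nem.comp_clm seg).clm_comp integ

lemma norm_avg_le (g : E → E) (hg : BD (fderiv ℝ g)) (hb : ∀ x, ‖fderiv ℝ g x‖ ≤ 1 / 2)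
    (p : E × E) : ‖avg g hg p‖ ≤ 1 / 2 := by
  refine (norm_integ_le _).trans ((Pth.norm_le (by norm_num)).2 fun t => hb _)

/-- The inverse of the averaged derivative. -/
noncomputable def hinv (g : E → E) (hg : BD (fderiv ℝ g)) (A : E ≃L[ℝ] E) (p : E × E) :
    E →L[ℝ] E :=
  (Ring.inverse (1 + avg g hg p)).comp (A.symm : E →L[ℝ] E)

lemma hinv_BD (g : E → E) (hg : BD (fderiv ℝ g)) (hb : ∀ x, ‖fderiv ℝ g x‖ ≤ 1 / 2)
    (A : E ≃L[ℝ] E) : BD (hinv g hg A) := by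
  have : ProperSpace (E →L[ℝ] E) := FiniteDimensional.proper ℝ _
  have h1 : BD (fun p => Ring.inverse (1 + avg g hg p)) := by
    refine ((BD.const (1 : E →L[ℝ] E)).add (avg_BD g hg)).comp_compact
      (K := Metric.closedBall 1 (1 / 2)) (U := {x | IsUnit x}) (isCompact_closedBall _ _)
      Units.isOpen ?_ ?_ (g := Ring.inverse) ?_
    · intro T hT
      have := isUnit_one_add (R := T - 1) (by simpa [dist_eq_norm] using hT)
      simpa using this
    · intro p
      rw [Metric.mem_closedBall, dist_eq_norm]
      simpa using norm_avg_le g hg hb p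
    · rintro _ ⟨u, rfl⟩
      exact (contDiffAt_ringInverse ℝ u).contDiffWithinAt
  exact h1.clm_comp ((ContinuousLinearMap.compL ℝ E E E).flip (A.symm : E →L[ℝ] E))

lemma fderiv_full (g : E → E) (hg : ContDiff ℝ ∞ g) (A : E ≃L[ℝ] E) (x₀ y : E) :
    HasFDerivAt (fun y => x₀ + A (y + g y))
      ((A : E →L[ℝ] E) + (A : E →L[ℝ] E).comp (fderiv ℝ g y)) y := by
  have h1 : HasFDerivAt (fun y => y + g y) (ContinuousLinearMap.id ℝ E + fderiv ℝ g y) y :=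
    (hasFDerivAt_id y).add (hg.differentiable (by simp) y).hasFDerivAt
  have h2 := ((A : E →L[ℝ] E).hasFDerivAt.comp y h1).const_add x₀
  refine HasFDerivAt.congr_fderiv h2 ?_
  ext v
  simp

lemma integral_full (g : E → E) (hg : ContDiff ℝ ∞ g) (hd : BD (fderiv ℝ g)) (A : E ≃L[ℝ] E)
    (x₀ x y : E) :
    ∫ t in (0 : ℝ)..1, fderiv ℝ (fun y => x₀ + A (y + g y)) (x + t • (y - x))
      = (A : E →L[ℝ] E).comp (1 + avg g hd (x, y)) := by
  have hc : Continuous fun t : ℝ => fderiv ℝ g (x + t • (y - x)) :=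
    hd.1.continuous.comp (by fun_prop)
  have e : ∀ t : ℝ, fderiv ℝ (fun y => x₀ + A (y + g y)) (x + t • (y - x))
      = (A : E →L[ℝ] E) + ContinuousLinearMap.compL ℝ E E E (A : E →L[ℝ] E)
        (fderiv ℝ g (x + t • (y - x))) := fun t => (fderiv_full g hg A x₀ _).fderiv
  simp_rw [e]
  have hi : IntervalIntegrable (fun t : ℝ => ContinuousLinearMap.compL ℝ E E E (A : E →L[ℝ] E)
      (fderiv ℝ g (x + t • (y - x)))) volume 0 1 :=
    ((ContinuousLinearMap.compL ℝ E E E (A : E →L[ℝ] E)).continuous.comp hc).intervalIntegrable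
      _ _
  rw [intervalIntegral.integral_add (by simp) hi,
    ContinuousLinearMap.intervalIntegral_comp_comm _ (hc.intervalIntegrable _ _),
    ← avg_eq g hd]
  ext v
  simp

lemma hinv_right (g : E → E) (hg : BD (fderiv ℝ g)) (hb : ∀ x, ‖fderiv ℝ g x‖ ≤ 1 / 2)
    (A : E ≃L[ℝ] E) (p : E × E) :
    ((A : E →L[ℝ] E).comp (1 + avg g hg p)).comp (hinv g hg A p)
      = ContinuousLinearMap.id ℝ E := by
  have h := Ring.mul_inverse_cancel _ (isUnit_one_add (norm_avg_le g hg hb p))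
  ext v
  have h' := congrArg (fun T : E →L[ℝ] E => T (A.symm v)) h
  have h'' : (1 + avg g hg p) (Ring.inverse (1 + avg g hg p) (A.symm v)) = A.symm v := h'
  change A ((1 + avg g hg p) (Ring.inverse (1 + avg g hg p) (A.symm v))) = v
  rw [h'']
  simp

lemma hinv_left (g : E → E) (hg : BD (fderiv ℝ g)) (hb : ∀ x, ‖fderiv ℝ g x‖ ≤ 1 / 2)
    (A : E ≃L[ℝ] E) (p : E × E) :
    (hinv g hg A p).comp ((A : E →L[ℝ] E).comp (1 + avg g hg p))
      = ContinuousLinearMap.id ℝ E := by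
  have h := Ring.inverse_mul_cancel _ (isUnit_one_add (norm_avg_le g hg hb p))
  ext v
  have h' : Ring.inverse (1 + avg g hg p) ((1 + avg g hg p) v) = v :=
    congrArg (fun T : E →L[ℝ] E => T v) h
  change Ring.inverse (1 + avg g hg p) (A.symm (A ((1 + avg g hg p) v))) = v
  rw [A.symm_apply_apply, h']

lemma norm_adjoint_bounds (g : E → E) (hg : BD (fderiv ℝ g))
    (hb : ∀ x, ‖fderiv ℝ g x‖ ≤ 1 / 2) (A : E ≃L[ℝ] E) :
    ∃ C : ℝ, 0 < C ∧ ∀ p η, C⁻¹ * ‖η‖ ≤ ‖ContinuousLinearMap.adjoint (hinv g hg A p) η‖ ∧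
      ‖ContinuousLinearMap.adjoint (hinv g hg A p) η‖ ≤ C * ‖η‖ := by
  obtain ⟨K, hK⟩ := (hinv_BD g hg hb A).2 0
  have hK' : ∀ p, ‖hinv g hg A p‖ ≤ K := fun p => by
    have := hK p
    rwa [norm_iteratedFDeriv_zero] at this
  have hB : ∃ M : ℝ, ∀ p, ‖(A : E →L[ℝ] E).comp (1 + avg g hg p)‖ ≤ M := by
    refine ⟨‖(A : E →L[ℝ] E)‖ * (1 + 1 / 2), fun p => ?_⟩
    refine (ContinuousLinearMap.opNorm_comp_le _ _).trans ?_
    gcongr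
    refine (norm_add_le _ _).trans (add_le_add ?_ (norm_avg_le g hg hb p))
    exact ContinuousLinearMap.norm_id_le
  obtain ⟨M, hM⟩ := hB
  have hC : (0 : ℝ) < |K| + |M| + 1 := by positivity
  refine ⟨|K| + |M| + 1, hC, fun p η => ⟨?_, ?_⟩⟩
  · rw [inv_mul_le_iff₀ hC]
    have h := congrArg ContinuousLinearMap.adjoint (hinv_left g hg hb A p)
    rw [ContinuousLinearMap.adjoint_comp (hinv g hg A p)] at h
    have h1 : ContinuousLinearMap.adjoint ((A : E →L[ℝ] E).comp (1 + avg g hg p))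
        (ContinuousLinearMap.adjoint (hinv g hg A p) η) = η := by
      have := congrArg (fun T : E →L[ℝ] E => T η) h
      simpa [ContinuousLinearMap.adjoint_id] using this
    have h2 := ContinuousLinearMap.le_opNorm
      (ContinuousLinearMap.adjoint ((A : E →L[ℝ] E).comp (1 + avg g hg p)))
      (ContinuousLinearMap.adjoint (hinv g hg A p) η)
    rw [h1, LinearIsometryEquiv.norm_map] at h2
    refine h2.trans ?_
    gcongr
    have := hM p
    linarith [le_abs_self M, abs_nonneg K]
  · refine (ContinuousLinearMap.le_opNorm _ _).trans ?_
    gcongr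
    rw [LinearIsometryEquiv.norm_map]
    have := hK' p
    linarith [le_abs_self K, abs_nonneg M]

end Global

section Main

variable {E : Type} [NormedAddCommGroup E] [InnerProductSpace ℝ E] [FiniteDimensional ℝ E]

lemma local_chart (ν : E → E) (hν : ContDiff ℝ ∞ ν) (x₀ eN : E) (heN : ‖eN‖ = 1)
    (hνn : ⟪ν x₀, eN⟫ ≠ 0) :
    ∃ (φ : E → E) (A : E ≃L[ℝ] E),
      (∀ᶠ y in 𝓝 (0 : E), ContDiffAt ℝ ∞ φ y ∧ fderiv ℝ φ y eN = ν (φ y)) ∧ φ 0 = x₀ ∧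
      HasFDerivAt φ (A : E →L[ℝ] E) 0 := by
  obtain ⟨ϕ, hϕ⟩ := local_flow ν hν x₀
  have hee : ⟪eN, eN⟫ = 1 := by
    rw [real_inner_self_eq_norm_sq, heN]; norm_num
  let j : E → E × ℝ := fun y => (x₀ + (y - ⟪eN, y⟫ • eN), ⟪eN, y⟫)
  have hj : ContDiff ℝ ∞ j := by
    have : ContDiff ℝ ∞ fun y : E => ⟪eN, y⟫ := (innerSL ℝ eN).contDiff
    exact (contDiff_const.add (contDiff_id.sub (this.smul contDiff_const))).prodMk this
  have hj0 : j 0 = (x₀, 0) := by simp [j]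
  have hev : ∀ᶠ y in 𝓝 (0 : E), ContDiffAt ℝ ∞ ϕ (j y) ∧
      HasDerivAt (fun s => ϕ ((j y).1, s)) (ν (ϕ (j y))) (j y).2 ∧ ϕ ((j y).1, 0) = (j y).1 :=
    hj.continuous.continuousAt.eventually (by rw [hj0]; exact hϕ)
  let φ : E → E := fun y => ϕ (j y)
  have hφ : ∀ᶠ y in 𝓝 (0 : E), ContDiffAt ℝ ∞ φ y ∧ fderiv ℝ φ y eN = ν (φ y) := by
    filter_upwards [hev] with y ⟨h1, h2, h3⟩
    have hs : ContDiffAt ℝ ∞ φ y := h1.comp y hj.contDiffAt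
    refine ⟨hs, ?_⟩
    have d1 := (hs.differentiableAt (by simp)).hasFDerivAt.hasLineDerivAt eN
    have hjt : ∀ t : ℝ, j (y + t • eN) = ((j y).1, (j y).2 + t) := by
      intro t
      simp only [j, inner_add_right, real_inner_smul_right, hee, mul_one, Prod.mk.injEq,
        and_true, add_smul]
      abel
    have d2 : HasLineDerivAt ℝ φ (ν (φ y)) y eN := by
      unfold HasLineDerivAt
      simp only [φ, hjt]
      have h2' : HasDerivAt (fun s => ϕ ((j y).1, s)) (ν (ϕ (j y))) ((j y).2 + 0) := by
        rw [add_zero]; exact h2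
      exact h2'.comp_const_add _ _
    exact d1.unique d2
  have hφ0 : φ 0 = x₀ := by
    have := hev.self_of_nhds.2.2
    rw [hj0] at this
    simp only [φ, hj0]
    exact this
  have hd := (hφ.self_of_nhds.1.differentiableAt (by simp)).hasFDerivAt
  set A := fderiv ℝ φ 0 with hA
  have hAe : A eN = ν x₀ := by
    rw [hφ.self_of_nhds.2, hφ0]
  have hAw : ∀ w, ⟪eN, w⟫ = 0 → A w = w := by
    intro w hw
    have d1 := hd.hasLineDerivAt w
    have d2 : HasLineDerivAt ℝ φ w 0 w := by
      unfold HasLineDerivAt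
      have d3 : HasDerivAt (fun t : ℝ => x₀ + t • w) w 0 := by
        simpa using ((hasDerivAt_id (0 : ℝ)).smul_const w).const_add x₀
      refine d3.congr_of_eventuallyEq ?_
      have hc : ContinuousAt (fun t : ℝ => t • w) 0 := by fun_prop
      have h00 : (0 : ℝ) • w = 0 := zero_smul ℝ w
      have := hc.tendsto.eventually (by rw [h00]; exact hev)
      filter_upwards [this] with t ht
      have hjt : j (t • w) = (x₀ + t • w, 0) := by
        simp [j, real_inner_smul_right, hw]
      have h3 := ht.2.2
      simp only [hjt] at h3
      simp only [zero_add, φ, hjt, h3]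
    exact d1.unique d2
  have hinj : Function.Injective (A : E →ₗ[ℝ] E) := by
    rw [← LinearMap.ker_eq_bot, LinearMap.ker_eq_bot']
    intro v hv
    have hv' : A v = 0 := hv
    set c := ⟪eN, v⟫ with hc
    have hw : ⟪eN, v - c • eN⟫ = 0 := by
      rw [inner_sub_right, real_inner_smul_right, hee, hc]; ring
    have h1 : A v = c • ν x₀ + (v - c • eN) := by
      rw [← hAw _ hw, ← hAe, ← map_smul, ← map_add]
      congr 1
      abel
    rw [hv'] at h1
    have h2 := congrArg (fun z => ⟪z, eN⟫) h1
    simp only [inner_zero_left, inner_add_left, real_inner_smul_left] at h2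
    rw [real_inner_comm eN (v - c • eN), hw, add_zero] at h2
    have hc0 : c = 0 := by
      rcases mul_eq_zero.1 h2.symm with h | h
      · exact h
      · exact absurd h hνn
    rw [hc0] at h1
    simpa using h1.symm
  refine ⟨φ, (LinearEquiv.ofInjectiveEndo (A : E →ₗ[ℝ] E) hinj).toContinuousLinearEquiv, hφ,
    hφ0, ?_⟩
  refine hd.congr_fderiv ?_
  ext v
  rfl

theorem main (ν : E → E) (hν : ContDiff ℝ ∞ ν) (x₀ eN : E) (heN : ‖eN‖ = 1)
    (hνn : ⟪ν x₀, eN⟫ ≠ 0) :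
    ∃ (r C : ℝ) (Φ Ψ : E → E) (Hinv : E → E → (E →L[ℝ] E)),
      0 < r ∧ 0 < C ∧
      Function.Bijective Φ ∧
      Function.LeftInverse Ψ Φ ∧ Function.RightInverse Ψ Φ ∧
      ContDiff ℝ ∞ Φ ∧
      (∀ i : ℕ, 1 ≤ i → ∃ K : ℝ, ∀ x, ‖iteratedFDeriv ℝ i Φ x‖ ≤ K) ∧
      ContDiff ℝ ∞ Ψ ∧
      (∀ i : ℕ, 1 ≤ i → ∃ K : ℝ, ∀ x, ‖iteratedFDeriv ℝ i Ψ x‖ ≤ K) ∧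
      (∀ x y : E,
        (∫ t in (0:ℝ)..1, fderiv ℝ Φ (x + t • (y - x))).comp (Hinv x y)
            = ContinuousLinearMap.id ℝ E ∧
        (Hinv x y).comp (∫ t in (0:ℝ)..1, fderiv ℝ Φ (x + t • (y - x)))
            = ContinuousLinearMap.id ℝ E) ∧
      ContDiff ℝ ∞ (fun p : E × E => Hinv p.1 p.2) ∧
      (∀ i : ℕ, ∃ K : ℝ, ∀ p : E × E,
          ‖iteratedFDeriv ℝ i (fun q : E × E => Hinv q.1 q.2) p‖ ≤ K) ∧
      (∀ y η : E,
        C⁻¹ * ‖η‖ ≤ ‖ContinuousLinearMap.adjoint (Hinv y y) η‖ ∧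
        ‖ContinuousLinearMap.adjoint (Hinv y y) η‖ ≤ C * ‖η‖) ∧
      (∀ u : E → ℝ, ContDiff ℝ 1 u → ∀ y : E, Φ y ∈ Metric.ball x₀ r →
          fderiv ℝ u (Φ y) (ν (Φ y)) = fderiv ℝ (u ∘ Φ) y eN) := by
  obtain ⟨φ, A, hφ, hφ0, hφd⟩ := local_chart ν hν x₀ eN heN hνn
  obtain ⟨g, hg, hgs, hgb, δ, hδ, hgk⟩ := exists_cutoff (fun y => A.symm (φ y - x₀) - y)
    (by
      filter_upwards [hφ] with y hy
      exact (A.symm.contDiff.contDiffAt.comp y (hy.1.sub contDiffAt_const)).sub contDiffAt_id)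
    (by simp [hφ0])
    (by
      have h1 : HasFDerivAt (fun y => A.symm (φ y - x₀) - y)
          ((A.symm : E →L[ℝ] E).comp (A : E →L[ℝ] E) - ContinuousLinearMap.id ℝ E) 0 :=
        ((A.symm : E →L[ℝ] E).hasFDerivAt.comp (0 : E) (hφd.sub_const x₀)).sub
          (hasFDerivAt_id (0 : E))
      rw [h1.fderiv]
      ext v
      simp)
  have hdg : BD (fderiv ℝ g) :=
    BD.of_hasCompactSupport (hg.fderiv_right (m := ∞) (by simp)) (hgs.fderiv ℝ)
  obtain ⟨Θ, hΘ⟩ := perturb g hg hgb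
  have hΘs := perturb_smooth g hg hgb Θ hΘ
  let Φ : E ≃ₜ E := (Θ.trans A.toHomeomorph).trans (Homeomorph.addLeft x₀)
  have hΦ : ∀ y, Φ y = x₀ + A (y + g y) := fun y => by
    rw [← hΘ]; rfl
  have hΦf : (Φ : E → E) = fun y => x₀ + A (y + g y) := funext hΦ
  have hΦs : ContDiff ℝ ∞ Φ := by
    rw [hΦf]
    exact contDiff_const.add (A.contDiff.comp (contDiff_id.add hg))
  have hΨf : (Φ.symm : E → E) = fun x => Θ.symm (A.symm (-x₀ + x)) := rfl
  have hΨs : ContDiff ℝ ∞ Φ.symm := by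
    rw [hΨf]
    exact hΘs.comp (A.symm.contDiff.comp (contDiff_const.add contDiff_id))
  have hfdΦ : fderiv ℝ Φ = fun y => (A : E →L[ℝ] E) +
      ContinuousLinearMap.compL ℝ E E E (A : E →L[ℝ] E) (fderiv ℝ g y) := by
    rw [hΦf]
    exact funext fun y => (fderiv_full g hg A x₀ y).fderiv
  have hBΦ : BD (fderiv ℝ Φ) := by
    rw [hfdΦ]
    exact (BD.const _).add (hdg.clm_comp _)
  have hgΨ : ContDiff ℝ ∞ (g ∘ Φ.symm) := hg.comp hΨs
  have hgΨd : BD (fderiv ℝ (g ∘ Φ.symm)) :=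
    BD.of_hasCompactSupport (hgΨ.fderiv_right (m := ∞) (by simp))
      ((hgs.comp_homeomorph Φ.symm).fderiv ℝ)
  have hΨeq : (Φ.symm : E → E) = fun x => A.symm (x - x₀) - (g ∘ Φ.symm) x := by
    funext x
    have h1 : Φ (Φ.symm x) = x := Φ.apply_symm_apply x
    rw [hΦ] at h1
    have h2 : A.symm (x - x₀) = Φ.symm x + g (Φ.symm x) := by
      rw [← A.symm_apply_apply (Φ.symm x + g (Φ.symm x))]
      congr 1
      exact sub_eq_of_eq_add' h1.symm
    rw [h2]
    simp
  have hfdΨ : fderiv ℝ Φ.symm = fun x => (A.symm : E →L[ℝ] E) +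
      (-ContinuousLinearMap.id ℝ (E →L[ℝ] E)) (fderiv ℝ (g ∘ Φ.symm) x) := by
    funext x
    have h1 : HasFDerivAt (fun x => A.symm (x - x₀))
        ((A.symm : E →L[ℝ] E).comp (ContinuousLinearMap.id ℝ E)) x :=
      (A.symm : E →L[ℝ] E).hasFDerivAt.comp x ((hasFDerivAt_id x).sub_const x₀)
    have h2 := h1.sub (hgΨ.differentiable (by simp) x).hasFDerivAt
    have h3 : HasFDerivAt Φ.symm _ x :=
      h2.congr_of_eventuallyEq (Filter.Eventually.of_forall fun z => congrFun hΨeq z)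
    rw [h3.fderiv]
    ext v
    simp [sub_eq_add_neg]
  have hBΨ : BD (fderiv ℝ Φ.symm) := by
    rw [hfdΨ]
    exact (BD.const _).add (hgΨd.clm_comp _)
  obtain ⟨C, hC, hCb⟩ := norm_adjoint_bounds g hdg hgb A
  -- the local identification
  have hloc : ∀ᶠ y in 𝓝 (0 : E), fderiv ℝ Φ y eN = ν (Φ y) := by
    have hb : ∀ᶠ y in 𝓝 (0 : E), Φ y = φ y := by
      filter_upwards [Metric.ball_mem_nhds (0 : E) hδ] with y hy
      rw [hΦ, hgk y hy]
      simp
    filter_upwards [hb.eventually_nhds, hφ] with y h1 h2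
    have h3 : (Φ : E → E) =ᶠ[𝓝 y] φ := h1
    rw [h3.fderiv_eq, h2.2, h1.self_of_nhds]
  have hΦ0 : Φ 0 = x₀ := by
    rw [hΦ, hgk 0 (Metric.mem_ball_self hδ)]
    simp [hφ0]
  have hΨ0 : Φ.symm x₀ = 0 := by
    rw [← hΦ0]; exact Φ.symm_apply_apply 0
  have hpull : ∀ᶠ x in 𝓝 x₀, fderiv ℝ Φ (Φ.symm x) eN = ν (Φ (Φ.symm x)) :=
    Φ.symm.continuous.continuousAt.eventually (by rw [hΨ0]; exact hloc)
  obtain ⟨r, hr, hrb⟩ := Metric.eventually_nhds_iff_ball.1 hpull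
  refine ⟨r, C, Φ, Φ.symm, fun x y => hinv g hdg A (x, y), hr, hC, Φ.bijective,
    Φ.symm_apply_apply, Φ.apply_symm_apply, hΦs, hBΦ.bdd_of_fderiv, hΨs, hBΨ.bdd_of_fderiv,
    fun x y => ?_, (hinv_BD g hdg hgb A).1, (hinv_BD g hdg hgb A).2, fun y η => hCb _ _, ?_⟩
  · rw [hΦf, integral_full g hg hdg A]
    exact ⟨hinv_right g hdg hgb A _, hinv_left g hdg hgb A _⟩
  · intro u hu y hy
    have h1 := hrb _ hy
    rw [Φ.symm_apply_apply] at h1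
    rw [fderiv_comp y (hu.differentiable (by simp) _) (hΦs.differentiable (by simp) _)]
    rw [ContinuousLinearMap.comp_apply, h1]

end Main

end Straighten


/-- Straightening of a non-vanishing smooth vector field near a point: given smooth
`ν : ℝⁿ → ℝⁿ` and `x₀` with `ν(x₀) ≠ 0`, and Euclidean coordinates chosen so that
`ν(x₀)·e_n ≠ 0` (here `e_n` is a unit vector with `⟪ν x₀, e_n⟫ ≠ 0`), there exist
`r, C > 0` and a map `Φ` (with inverse `Ψ` and with `Hinv x y` inverting
`H(x,y) = ∫_0^1 DΦ(x+t(y-x)) dt`) satisfying (i)–(iv). -/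
theorem stmt_17 (n : ℕ)
    (ν : EuclideanSpace ℝ (Fin (n + 1)) → EuclideanSpace ℝ (Fin (n + 1)))
    (hν : ContDiff ℝ (⊤ : ℕ∞) ν)
    (x₀ : EuclideanSpace ℝ (Fin (n + 1))) (h₀ : ν x₀ ≠ 0)
    (eN : EuclideanSpace ℝ (Fin (n + 1))) (heN : ‖eN‖ = 1)
    (hνn : ⟪ν x₀, eN⟫ ≠ 0) :
    ∃ (r C : ℝ)
      (Φ Ψ : EuclideanSpace ℝ (Fin (n + 1)) → EuclideanSpace ℝ (Fin (n + 1)))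
      (Hinv : EuclideanSpace ℝ (Fin (n + 1)) → EuclideanSpace ℝ (Fin (n + 1)) →
        (EuclideanSpace ℝ (Fin (n + 1)) →L[ℝ] EuclideanSpace ℝ (Fin (n + 1)))),
      0 < r ∧ 0 < C ∧
      -- (i) Φ is a bijection with smooth inverse Ψ, both with bounded derivatives
      Function.Bijective Φ ∧
      Function.LeftInverse Ψ Φ ∧ Function.RightInverse Ψ Φ ∧
      ContDiff ℝ (⊤ : ℕ∞) Φ ∧
      (∀ i : ℕ, 1 ≤ i → ∃ K : ℝ, ∀ x, ‖iteratedFDeriv ℝ i Φ x‖ ≤ K) ∧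
      ContDiff ℝ (⊤ : ℕ∞) Ψ ∧
      (∀ i : ℕ, 1 ≤ i → ∃ K : ℝ, ∀ x, ‖iteratedFDeriv ℝ i Ψ x‖ ≤ K) ∧
      -- (ii) H(x,y) = ∫_0^1 DΦ(x+t(y-x)) dt is invertible with inverse Hinv x y,
      --      and (x,y) ↦ Hinv x y is smooth with bounded derivatives of all orders
      (∀ x y : EuclideanSpace ℝ (Fin (n + 1)),
        (∫ t in (0:ℝ)..1, fderiv ℝ Φ (x + t • (y - x))).comp (Hinv x y)
            = ContinuousLinearMap.id ℝ (EuclideanSpace ℝ (Fin (n + 1))) ∧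
        (Hinv x y).comp (∫ t in (0:ℝ)..1, fderiv ℝ Φ (x + t • (y - x)))
            = ContinuousLinearMap.id ℝ (EuclideanSpace ℝ (Fin (n + 1)))) ∧
      ContDiff ℝ (⊤ : ℕ∞)
        (fun p : EuclideanSpace ℝ (Fin (n + 1)) × EuclideanSpace ℝ (Fin (n + 1)) =>
          Hinv p.1 p.2) ∧
      (∀ i : ℕ, ∃ K : ℝ,
        ∀ p : EuclideanSpace ℝ (Fin (n + 1)) × EuclideanSpace ℝ (Fin (n + 1)),
          ‖iteratedFDeriv ℝ i
              (fun q : EuclideanSpace ℝ (Fin (n + 1)) × EuclideanSpace ℝ (Fin (n + 1)) =>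
                Hinv q.1 q.2) p‖ ≤ K) ∧
      -- (iii) C⁻¹|η| ≤ |((DΦ(y))⁻¹)ᵀ η| ≤ C|η|  (note Hinv y y = (DΦ(y))⁻¹ by (ii))
      (∀ y η : EuclideanSpace ℝ (Fin (n + 1)),
        C⁻¹ * ‖η‖ ≤ ‖ContinuousLinearMap.adjoint (Hinv y y) η‖ ∧
        ‖ContinuousLinearMap.adjoint (Hinv y y) η‖ ≤ C * ‖η‖) ∧
      -- (iv) ν(Φ(y))·∇u(Φ(y)) = ∂_{y_n}(u ∘ Φ)(y) for Φ(y) ∈ B_r(x₀)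
      (∀ u : EuclideanSpace ℝ (Fin (n + 1)) → ℝ, ContDiff ℝ 1 u →
        ∀ y : EuclideanSpace ℝ (Fin (n + 1)), Φ y ∈ Metric.ball x₀ r →
          fderiv ℝ u (Φ y) (ν (Φ y)) = fderiv ℝ (u ∘ Φ) y eN) := by
  exact Straighten.main ν hν x₀ eN heN hνn
end

section
/- Let s ∈ (0,1) and define Φ_s : (0,∞) → ℝ by Φ_s(x) = Re[ (i/π) ∫_{0}^{∞} exp(−x r − e^{iπs} r^s) dr ]. Then for every λ > 0, ∫_{0}^{∞} Φ_s(x) e^{−λ x} dx = e^{−λ^s}; that is, Φ_s is the subordination density whose Laplace transform is e^{−λ^s}. -/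
/-- The subordination density `Φ_s(x) = Re[(i/π) ∫_0^∞ exp(-xr - e^{iπs} r^s) dr]`. -/
noncomputable def subordinationDensity (s : ℝ) (x : ℝ) : ℝ :=
  (Complex.I / (Real.pi : ℂ) *
      ∫ r in Set.Ioi (0 : ℝ),
        Complex.exp (-((x * r : ℝ) : ℂ) -
          Complex.exp (Complex.I * (Real.pi : ℂ) * (s : ℂ)) * ((r ^ s : ℝ) : ℂ))).re

open MeasureTheory Filter Topology Set

lemma aux_strip_int (F : ℝ → ℂ) (hF : Continuous F) 
    (hlow : ∃ M : ℝ, ∀ᶠ u : ℝ in atBot, ‖F u‖ ≤ M * Real.exp u)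
    (hhigh : ∃ M : ℝ, ∀ᶠ u : ℝ in atTop, ‖F u‖ ≤ M * Real.exp (-u)) : Integrable F := by
  obtain ⟨M, hM⟩ := hlow
  obtain ⟨M', hM'⟩ := hhigh
  refine hF.locallyIntegrable.integrable_of_isBigO_atBot_atTop (g := Real.exp)
    (g' := fun u => Real.exp (-u)) ?_ ?_ ?_ ?_
  · refine Asymptotics.IsBigO.of_bound M ?_
    filter_upwards [hM] with u hu
    simpa using hu
  · exact ⟨Iic 0, Iic_mem_atBot 0, integrableOn_exp_Iic 0⟩
  · refine Asymptotics.IsBigO.of_bound M' ?_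
    filter_upwards [hM'] with u hu
    simpa using hu
  · exact ⟨Ioi 0, Ioi_mem_atTop 0, integrableOn_exp_neg_Ioi 0⟩

lemma aux_strip (G : ℂ → ℂ) (a b : ℝ) (hab : a ≤ b)
    (hG : DifferentiableOn ℂ G {w | w.im ∈ Icc a b})
    (hlow : ∃ M : ℝ, ∀ᶠ u : ℝ in atBot, ∀ v ∈ Icc a b,
      ‖G (u + v * Complex.I)‖ ≤ M * Real.exp u)
    (hhigh : ∃ M : ℝ, ∀ᶠ u : ℝ in atTop, ∀ v ∈ Icc a b,
      ‖G (u + v * Complex.I)‖ ≤ M * Real.exp (-u)) :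
    (∀ v ∈ Icc a b, Integrable (fun u : ℝ => G (u + v * Complex.I))) ∧
    ∫ u : ℝ, G (u + a * Complex.I) = ∫ u : ℝ, G (u + b * Complex.I) := by
  obtain ⟨M, hM⟩ := hlow
  obtain ⟨M', hM'⟩ := hhigh
  have hint : ∀ v ∈ Icc a b, Integrable (fun u : ℝ => G (u + v * Complex.I)) := by
    intro v hv
    apply aux_strip_int
    · refine hG.continuousOn.comp_continuous (by fun_prop) ?_
      intro u
      simpa using hv
    · exact ⟨M, hM.mono fun u hu => hu v hv⟩
    · exact ⟨M', hM'.mono fun u hu => hu v hv⟩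
  refine ⟨hint, ?_⟩
  have hrect : ∀ R : ℝ, 
    (∫ x : ℝ in (-R)..R, G (x + a * Complex.I)) - (∫ x : ℝ in (-R)..R, G (x + b * Complex.I)) +
      Complex.I * (∫ y : ℝ in a..b, G ((R:ℝ) + y * Complex.I)) -
      Complex.I * (∫ y : ℝ in a..b, G ((-R : ℝ) + y * Complex.I)) = 0 := by
    intro R
    have := Complex.integral_boundary_rect_eq_zero_of_differentiableOn G ⟨-R, a⟩ ⟨R, b⟩ (by
      refine hG.mono ?_
      intro w hw
      have := hw.2
      simpa [uIcc_of_le hab] using this)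
    simpa using this
  have h1 := intervalIntegral_tendsto_integral (hint a ⟨le_rfl, hab⟩) tendsto_neg_atTop_atBot tendsto_id
  have h2 := intervalIntegral_tendsto_integral (hint b ⟨hab, le_rfl⟩) tendsto_neg_atTop_atBot tendsto_id
  have h3 : Tendsto (fun R : ℝ => ∫ y : ℝ in a..b, G ((R:ℝ) + y * Complex.I)) atTop (𝓝 0) := by
    have hb : Tendsto (fun R : ℝ => M' * Real.exp (-R) * |b - a|) atTop (𝓝 0) := by
      simpa using ((Real.tendsto_exp_neg_atTop_nhds_zero.const_mul M').mul_const |b-a|)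
    refine squeeze_zero_norm' ?_ hb
    filter_upwards [hM'] with R hR
    apply intervalIntegral.norm_integral_le_of_norm_le_const
    intro y hy
    rw [uIoc_of_le hab] at hy
    exact hR y ⟨hy.1.le, hy.2⟩
  have h4 : Tendsto (fun R : ℝ => ∫ y : ℝ in a..b, G ((-R:ℝ) + y * Complex.I)) atTop (𝓝 0) := by
    have hb : Tendsto (fun R : ℝ => M * Real.exp (-R) * |b - a|) atTop (𝓝 0) := by
      simpa using ((Real.tendsto_exp_neg_atTop_nhds_zero.const_mul M).mul_const |b-a|)
    refine squeeze_zero_norm' ?_ hb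
    filter_upwards [tendsto_neg_atTop_atBot.eventually hM] with R hR
    apply intervalIntegral.norm_integral_le_of_norm_le_const
    intro y hy
    rw [uIoc_of_le hab] at hy
    exact hR y ⟨hy.1.le, hy.2⟩
  have h5 := ((h1.sub h2).add (h3.const_mul Complex.I)).sub (h4.const_mul Complex.I)
  have h6 := tendsto_nhds_unique (h5.congr (fun R => hrect R)) tendsto_const_nhds
  simp at h6
  exact sub_eq_zero.mp h6

lemma aux_cov (g : ℝ → ℂ) : ∫ r in Ioi (0:ℝ), g r = ∫ u : ℝ, (Real.exp u : ℂ) * g (Real.exp u) := by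
  have h := integral_image_eq_integral_abs_deriv_smul (s := univ) (f := Real.exp) (f' := Real.exp)
    MeasurableSet.univ (fun x _ => (Real.hasDerivAt_exp x).hasDerivWithinAt)
    Real.exp_injective.injOn g
  rw [image_univ, Real.range_exp] at h
  rw [h, setIntegral_univ]
  simp

lemma aux_cov_int (g : ℝ → ℂ) : IntegrableOn g (Ioi 0) ↔
    Integrable fun u : ℝ => (Real.exp u : ℂ) * g (Real.exp u) := by
  have h := integrableOn_image_iff_integrableOn_abs_deriv_smul (s := univ) (f := Real.exp) (f' := Real.exp)
    MeasurableSet.univ (fun x _ => (Real.hasDerivAt_exp x).hasDerivWithinAt)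
    Real.exp_injective.injOn g
  rw [image_univ, Real.range_exp] at h
  rw [h, integrableOn_univ]
  simp

/- exp decay -/
lemma aux_decay (c s : ℝ) (hc : 0 < c) (hs : 0 < s) (k : ℝ) :
    ∀ᶠ r : ℝ in atTop, r ^ k * Real.exp (-(c * r ^ s)) ≤ 1 := by
  have h := (tendsto_rpow_mul_exp_neg_mul_atTop_nhds_zero (k / s) c hc).comp (tendsto_rpow_atTop hs)
  filter_upwards [h.eventually (gt_mem_nhds zero_lt_one), eventually_gt_atTop 0] with r hr h0
  simp only [Function.comp, ← Real.rpow_mul h0.le] at hr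
  rw [mul_div_cancel₀ _ hs.ne'] at hr
  rw [← neg_mul]
  exact hr.le

lemma aux_decay2 (c s : ℝ) (hc : 0 < c) (hs : 0 < s) (hs1 : s < 1) :
    ∀ᶠ r : ℝ in atTop, r ^ (2:ℝ) * Real.exp (-(c * r) + r ^ s) ≤ 1 := by
  have h1 := aux_decay (c/2) 1 (by positivity) one_pos 2
  have h2 := (tendsto_rpow_neg_atTop (y := 1 - s) (by linarith)).eventually
    (gt_mem_nhds (half_pos hc))
  filter_upwards [h1, h2, eventually_gt_atTop 0] with r hr hr2 h0
  refine le_trans ?_ hr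
  have h3 : r ^ s = r ^ (-(1 - s)) * r := by
    rw [← Real.rpow_add_one h0.ne']
    congr 1
    ring
  gcongr
  rw [Real.rpow_one, h3]
  nlinarith

noncomputable def auxG (s x : ℝ) (w : ℂ) : ℂ :=
  Complex.exp (x * Complex.exp w - Complex.exp (s * w)) * Complex.exp w

lemma aux_exp_rpow (u s : ℝ) : Real.exp u ^ s = Real.exp (s * u) := by
  rw [← Real.exp_mul, mul_comm]

lemma aux_norm_E (s u v : ℝ) : ‖Complex.exp (-Complex.exp (s * (u + v * Complex.I)))‖ =
    Real.exp (-((Real.exp u) ^ s * Real.cos (s * v))) := by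
  rw [Complex.norm_exp, aux_exp_rpow]
  simp [Complex.exp_re]

lemma auxG_norm (s x u v : ℝ) : ‖auxG s x (u + v * Complex.I)‖ =
    Real.exp (x * (Real.exp u * Real.cos v) - (Real.exp u) ^ s * Real.cos (s * v)) * Real.exp u := by
  unfold auxG
  rw [norm_mul, Complex.norm_exp, Complex.norm_exp, aux_exp_rpow]
  simp [Complex.exp_re]

lemma aux_cos_pos (s v : ℝ) (hs0 : 0 < s) (hs1 : s < 1) (hv0 : 0 ≤ v) (hv : v ≤ Real.pi / (1 + s)) :
    0 < Real.cos (s * (Real.pi / (1 + s))) ∧ 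
    Real.cos (s * (Real.pi / (1 + s))) ≤ Real.cos (s * v) := by
  have hpi := Real.pi_pos
  have h1 : s * (Real.pi / (1 + s)) < Real.pi / 2 := by
    rw [← mul_div_assoc, div_lt_iff₀ (by linarith)]
    nlinarith
  constructor
  · apply Real.cos_pos_of_mem_Ioo
    constructor
    · have : 0 < s * (Real.pi / (1 + s)) := by positivity
      linarith
    · exact h1
  · apply Real.cos_le_cos_of_nonneg_of_le_pi
    · positivity
    · linarith
    · gcongr

lemma aux_half (s : ℝ) (hs0 : 0 < s) (hs1 : s < 1) :  Real.pi / 2 < Real.pi / (1 + s) := by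
  have hpi := Real.pi_pos
  gcongr
  linarith

lemma auxG_strip (s x : ℝ) (hs0 : 0 < s) (hs1 : s < 1) (hx : 0 < x) :
    ∫ u : ℝ, auxG s x (u + (Real.pi / 2 : ℝ) * Complex.I) =
      ∫ u : ℝ, auxG s x (u + Real.pi * Complex.I) := by
  have hpi := Real.pi_pos
  have hth := aux_half s hs0 hs1
  set θ := Real.pi / (1 + s) with hθ
  have hθpi : θ < Real.pi := by
    rw [hθ, div_lt_iff₀ (by linarith)]
    nlinarith
  have hcθ : Real.cos θ < 0 := Real.cos_neg_of_pi_div_two_lt_of_lt hth (by linarith)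
  refine (aux_strip (auxG s x) (Real.pi / 2) Real.pi (by linarith) ?_ ?_ ?_).2
  · unfold auxG
    fun_prop
  · refine ⟨Real.exp 1, ?_⟩
    filter_upwards [eventually_le_atBot 0] with u hu v hv
    rw [auxG_norm]
    have hr : 0 < Real.exp u := Real.exp_pos u
    gcongr
    have hcv : Real.cos v ≤ 0 := Real.cos_nonpos_of_pi_div_two_le_of_le hv.1 (by linarith [hv.2])
    have h1 : (Real.exp u) ^ s ≤ 1 := Real.rpow_le_one hr.le (by simpa using hu) hs0.le
    have h2 : 0 < (Real.exp u) ^ s := Real.rpow_pos_of_pos hr s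
    have h3 := Real.neg_one_le_cos (s * v)
    have h4 : x * (Real.exp u * Real.cos v) ≤ 0 := 
      mul_nonpos_of_nonneg_of_nonpos hx.le (mul_nonpos_of_nonneg_of_nonpos hr.le hcv)
    nlinarith
  · refine ⟨1, ?_⟩
    set c := Real.cos (s * θ) with hc
    have hcpos : 0 < c := (aux_cos_pos s 0 hs0 hs1 le_rfl (by positivity)).1
    have e1 := aux_decay c s hcpos hs0 2
    have e2 := aux_decay2 (x * (-Real.cos θ)) s (mul_pos hx (by linarith)) hs0 hs1
    filter_upwards [Real.tendsto_exp_atTop.eventually e1, Real.tendsto_exp_atTop.eventually e2]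
      with u h1 h2 v hv
    rw [auxG_norm, Real.exp_neg, one_mul]
    set r := Real.exp u with hrdef
    have hr : 0 < r := Real.exp_pos u
    have hrs : 0 < r ^ s := Real.rpow_pos_of_pos hr s
    have hcv : Real.cos v ≤ 0 := Real.cos_nonpos_of_pi_div_two_le_of_le hv.1 (by linarith [hv.2])
    rw [← mul_le_mul_iff_left₀ hr, inv_mul_cancel₀ hr.ne', mul_assoc, ← sq, mul_comm]
    rw [Real.rpow_two] at h1 h2
    rcases le_total v θ with hvθ | hvθ
    · refine le_trans ?_ h1
      gcongr
      have h5 := (aux_cos_pos s v hs0 hs1 (by linarith [hv.1]) hvθ).2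
      have h4 : x * (r * Real.cos v) ≤ 0 := 
        mul_nonpos_of_nonneg_of_nonpos hx.le (mul_nonpos_of_nonneg_of_nonpos hr.le hcv)
      nlinarith
    · refine le_trans ?_ h2
      gcongr
      have h5 : Real.cos v ≤ Real.cos θ := 
        Real.cos_le_cos_of_nonneg_of_le_pi (by linarith) hv.2 hvθ
      have h3 := Real.neg_one_le_cos (s * v)
      have h6 : x * (r * Real.cos v) ≤ x * (r * Real.cos θ) := by gcongr
      nlinarith

lemma aux_density (s x : ℝ) (hs0 : 0 < s) (hs1 : s < 1) (hx : 0 < x) :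
    ∫ r in Set.Ioi (0 : ℝ),
        Complex.exp (-((x * r : ℝ) : ℂ) -
          Complex.exp (Complex.I * (Real.pi : ℂ) * (s : ℂ)) * ((r ^ s : ℝ) : ℂ)) = 
    -Complex.I * ∫ r in Set.Ioi (0 : ℝ), Complex.exp (Complex.I * x * r) *
          Complex.exp (-Complex.exp (s * (Real.log r + (Real.pi / 2 : ℝ) * Complex.I))) := by
  rw [aux_cov, aux_cov]
  have h := auxG_strip s x hs0 hs1 hx
  have e1 : ∀ u : ℝ, (Real.exp u : ℂ) * Complex.exp (-((x * Real.exp u : ℝ) : ℂ) -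
          Complex.exp (Complex.I * (Real.pi : ℂ) * (s : ℂ)) * ((Real.exp u ^ s : ℝ) : ℂ)) =
      - auxG s x (u + Real.pi * Complex.I) := by
    intro u
    unfold auxG
    rw [aux_exp_rpow, mul_add, Complex.exp_add, Complex.exp_add, Complex.exp_pi_mul_I]
    push_cast
    rw [show (s:ℂ) * (Real.pi * Complex.I) = Complex.I * Real.pi * s by ring]
    ring_nf
  have e2 : ∀ u : ℝ, (Real.exp u : ℂ) * (Complex.exp (Complex.I * x * Real.exp u) *
          Complex.exp (-Complex.exp (s * (Real.log (Real.exp u) + (Real.pi / 2 : ℝ) * Complex.I)))) =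
      -Complex.I * auxG s x (u + (Real.pi / 2 : ℝ) * Complex.I) := by
    intro u
    unfold auxG
    rw [Real.log_exp, ← Complex.exp_add, Complex.exp_add (u:ℂ)]
    have : Complex.exp ((Real.pi / 2 : ℝ) * Complex.I) = Complex.I := by
      push_cast
      exact Complex.exp_pi_div_two_mul_I
    rw [this]
    push_cast
    linear_combination ((Complex.exp u * Complex.exp (x * (Complex.exp u * Complex.I) -
      Complex.exp (s * (u + Real.pi / 2 * Complex.I))))) * Complex.I_mul_I + 
      (Complex.exp u) * congrArg Complex.exp (show Complex.I * x * Complex.exp u +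
        -Complex.exp (s * (u + Real.pi / 2 * Complex.I)) = x * (Complex.exp u * Complex.I) -
      Complex.exp (s * (u + Real.pi / 2 * Complex.I)) by ring)
  simp_rw [e1, e2]
  rw [integral_neg, integral_const_mul, ← h, ← mul_assoc]
  simp

noncomputable def auxN (s lam : ℝ) (w : ℂ) : ℂ :=
  Complex.exp (-Complex.exp (s * w)) -
    (Real.exp (-(lam ^ s)) : ℂ) * (2 * lam / (lam + Complex.exp w))

noncomputable def auxH (s lam : ℝ) (w : ℂ) : ℂ :=
  -(dslope (auxN s lam) (Real.log lam : ℂ) w / dslope Complex.exp (Real.log lam : ℂ) w) *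
    Complex.exp w

def auxS : Set ℂ := {w | w.im ∈ Ioo (-Real.pi) Real.pi}

lemma auxS_open : IsOpen auxS := isOpen_Ioo.preimage Complex.continuous_im

lemma aux_exp_log (lam : ℝ) (hlam : 0 < lam) : Complex.exp (Real.log lam : ℂ) = lam := by
  rw [← Complex.ofReal_exp, Real.exp_log hlam]

lemma aux_log_mem (lam : ℝ) : (Real.log lam : ℂ) ∈ auxS := by
  simp [auxS, Real.pi_pos]

lemma aux_ne (lam : ℝ) (hlam : 0 < lam) (w : ℂ) (hw : w ∈ auxS) : (lam : ℂ) + Complex.exp w ≠ 0 := by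
  intro h
  have h1 : Complex.exp w = ((-lam : ℝ) : ℂ) := by
    push_cast
    linear_combination h
  have h2 := Complex.log_exp hw.1 hw.2.le
  rw [h1] at h2
  have h3 := congrArg Complex.im h2
  rw [Complex.log_im, Complex.arg_ofReal_of_neg (by linarith)] at h3
  have := hw.2
  linarith

lemma auxN_zero (s lam : ℝ) (hlam : 0 < lam) : auxN s lam (Real.log lam : ℂ) = 0 := by
  unfold auxN
  rw [aux_exp_log lam hlam]
  have h : Complex.exp (s * (Real.log lam : ℂ)) = ((lam ^ s : ℝ) : ℂ) := by
    rw [Real.rpow_def_of_pos hlam]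
    push_cast
    rw [mul_comm]
  rw [h]
  have : (lam : ℂ) ≠ 0 := by exact_mod_cast hlam.ne'
  push_cast
  field_simp
  ring

lemma auxN_diff (s lam : ℝ) (hlam : 0 < lam) : DifferentiableOn ℂ (auxN s lam) auxS := by
  unfold auxN
  refine DifferentiableOn.sub (by fun_prop) (DifferentiableOn.const_mul ?_ _)
  refine DifferentiableOn.div (by fun_prop) (by fun_prop) ?_
  intro w hw
  exact aux_ne lam hlam w hw

lemma aux_exp_inj (a b : ℂ) (ha : a ∈ auxS) (hb : b ∈ auxS) (h : Complex.exp a = Complex.exp b) :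
    a = b := by
  rw [← Complex.log_exp ha.1 ha.2.le, h, Complex.log_exp hb.1 hb.2.le]

lemma auxH_diff (s lam : ℝ) (hlam : 0 < lam) : DifferentiableOn ℂ (auxH s lam) auxS := by
  have hn : auxS ∈ 𝓝 (Real.log lam : ℂ) := auxS_open.mem_nhds (aux_log_mem lam)
  unfold auxH
  refine DifferentiableOn.mul (DifferentiableOn.neg (DifferentiableOn.div ?_ ?_ ?_)) (by fun_prop)
  · exact (Complex.differentiableOn_dslope hn).2 (auxN_diff s lam hlam)
  · exact (Complex.differentiableOn_dslope hn).2 (by fun_prop)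
  · intro w hw
    by_cases h : w = (Real.log lam : ℂ)
    · rw [h, dslope_same, Complex.deriv_exp]
      exact Complex.exp_ne_zero _
    · rw [dslope_of_ne _ h, slope_def_field]
      refine div_ne_zero ?_ (sub_ne_zero.2 h)
      intro h'
      exact h (aux_exp_inj _ _ hw (aux_log_mem lam) (sub_eq_zero.1 h'))

lemma auxH_eq (s lam : ℝ) (hlam : 0 < lam) (w : ℂ) (hw : w ∈ auxS) (h : w ≠ (Real.log lam : ℂ)) :
    auxH s lam w = auxN s lam w / (lam - Complex.exp w) * Complex.exp w := by
  unfold auxH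
  rw [dslope_of_ne _ h, dslope_of_ne _ h, slope_def_field, slope_def_field, auxN_zero s lam hlam,
    aux_exp_log lam hlam]
  have h1 := sub_ne_zero.2 h
  have h2 : Complex.exp w - lam ≠ 0 := by
    intro h'
    rw [← aux_exp_log lam hlam] at h'
    exact h (aux_exp_inj _ _ hw (aux_log_mem lam) (sub_eq_zero.1 h'))
  have h3 : lam - Complex.exp w ≠ 0 := by
    rw [← neg_sub]; exact neg_ne_zero.2 h2
  field_simp
  ring

lemma auxS_of (v u : ℝ) (hv : v ∈ Icc 0 (Real.pi/2)) : (u + v * Complex.I : ℂ) ∈ auxS := by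
  have := Real.pi_pos
  simp only [auxS, mem_ofPred_eq, Complex.add_im, Complex.ofReal_im, Complex.mul_im, Complex.I_im,
    Complex.ofReal_re, Complex.I_re]
  constructor <;> linarith [hv.1, hv.2]

lemma aux_norm_low (lam u v : ℝ) (hlam : 0 < lam) (hv : v ∈ Icc 0 (Real.pi/2)) :
    max lam (Real.exp u) ≤ ‖(lam : ℂ) + Complex.exp (u + v * Complex.I)‖ := by
  have hc : 0 ≤ Real.cos v := Real.cos_nonneg_of_mem_Icc ⟨by linarith [hv.1, Real.pi_pos], hv.2⟩
  have hr := Real.exp_pos u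
  have h2 : ‖(lam : ℂ) + Complex.exp (u + v * Complex.I)‖ ^ 2 =
      lam ^ 2 + 2 * lam * (Real.exp u * Real.cos v) + (Real.exp u) ^ 2 := by
    rw [← Complex.normSq_eq_norm_sq, Complex.normSq_apply]
    simp [Complex.exp_re, Complex.exp_im]
    linear_combination (Real.exp u)^2 * Real.sin_sq_add_cos_sq v
  have h3 : 0 ≤ lam * (Real.exp u * Real.cos v) := by positivity
  apply max_le <;> apply le_of_sq_le_sq _ (norm_nonneg _) <;> rw [h2] <;> nlinarith

lemma auxH_strip (s lam : ℝ) (hs0 : 0 < s) (hs1 : s < 1) (hlam : 0 < lam) :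
    (∀ v ∈ Icc 0 (Real.pi/2), Integrable (fun u : ℝ => auxH s lam (u + v * Complex.I))) ∧
    ∫ u : ℝ, auxH s lam (u + (0:ℝ) * Complex.I) =
      ∫ u : ℝ, auxH s lam (u + (Real.pi / 2 : ℝ) * Complex.I) := by
  have hpi := Real.pi_pos
  have hhalf := aux_half s hs0 hs1
  set C := Real.exp (-(lam ^ s)) with hC
  have hCpos : 0 < C := Real.exp_pos _
  have hne : ∀ u v : ℝ, u ≠ Real.log lam → (u + v * Complex.I : ℂ) ≠ (Real.log lam : ℂ) := by
    intro u v h h'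
    apply h
    simpa using congrArg Complex.re h'
  have hN : ∀ u v : ℝ, v ∈ Icc 0 (Real.pi/2) → ‖auxN s lam (u + v * Complex.I)‖ ≤ 
      Real.exp (-(Real.cos (s * (Real.pi / (1 + s))) * (Real.exp u) ^ s)) + C * (2 * lam / max lam (Real.exp u)) := by
    intro u v hv
    unfold auxN
    refine (norm_sub_le _ _).trans (add_le_add ?_ ?_)
    · rw [aux_norm_E]
      have h5 := (aux_cos_pos s v hs0 hs1 hv.1 (by linarith [hv.2])).2
      rw [mul_comm]
      gcongr
    · rw [norm_mul, norm_div, Complex.norm_real, Real.norm_of_nonneg hCpos.le]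
      have : ‖(2 * lam : ℂ)‖ = 2 * lam := by
        simp [abs_of_pos hlam]
      rw [this]
      have := aux_norm_low lam u v hlam hv
      gcongr
  have hcpos := (aux_cos_pos s 0 hs0 hs1 le_rfl (by positivity)).1
  set c := Real.cos (s * (Real.pi / (1 + s))) with hc
  have hnorm : ∀ u v : ℝ, ‖Complex.exp (u + v * Complex.I)‖ = Real.exp u := by
    intro u v
    rw [Complex.norm_exp]; simp
  refine aux_strip (auxH s lam) 0 (Real.pi / 2) (by linarith) ?_ ?_ ?_
  · refine (auxH_diff s lam hlam).mono ?_
    intro w hw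
    simp only [mem_ofPred_eq] at hw
    exact ⟨by linarith [hw.1], by linarith [hw.2]⟩
  · refine ⟨(1 + C * 2) / (lam / 2), ?_⟩
    filter_upwards [eventually_lt_atBot (Real.log (lam / 2)), eventually_lt_atBot (Real.log lam)]
      with u hu1 hu2 v hv
    rw [auxH_eq s lam hlam _ (auxS_of v u hv) (hne u v hu2.ne), norm_mul, norm_div, hnorm]
    have hr : Real.exp u ≤ lam / 2 := by
      rw [← Real.exp_log (half_pos hlam)]
      gcongr
    have h1 : lam / 2 ≤ ‖(lam:ℂ) - Complex.exp (u + v * Complex.I)‖ := by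
      have := norm_sub_norm_le (lam:ℂ) (Complex.exp (u + v * Complex.I))
      rw [hnorm, Complex.norm_real, Real.norm_of_nonneg hlam.le] at this
      linarith
    have h2 := hN u v hv
    have h3 : Real.exp (-(c * (Real.exp u) ^ s)) ≤ 1 := by
      rw [Real.exp_le_one_iff]
      have : 0 < c * (Real.exp u) ^ s := by positivity
      linarith
    have h4 : 2 * lam / max lam (Real.exp u) = 2 := by
      rw [max_eq_left (by linarith)]
      field_simp
    rw [h4] at h2
    gcongr
    linarith
  · refine ⟨2 * (1 + C * (2 * lam)), ?_⟩
    have e1 := aux_decay c s hcpos hs0 1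
    filter_upwards [Real.tendsto_exp_atTop.eventually e1, eventually_gt_atTop (Real.log (2 * lam)),
      eventually_gt_atTop (Real.log lam)] with u hu0 hu1 hu2 v hv
    rw [auxH_eq s lam hlam _ (auxS_of v u hv) (hne u v hu2.ne'), norm_mul, norm_div, hnorm]
    have hr : 2 * lam ≤ Real.exp u := by
      rw [← Real.exp_log (show 0 < 2 * lam by linarith)]
      gcongr
    have h1 : Real.exp u / 2 ≤ ‖(lam:ℂ) - Complex.exp (u + v * Complex.I)‖ := by
      have := norm_sub_norm_le (Complex.exp (u + v * Complex.I)) (lam:ℂ) 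
      rw [hnorm, Complex.norm_real, Real.norm_of_nonneg hlam.le, norm_sub_rev] at this
      linarith
    have h2 := hN u v hv
    rw [max_eq_right (by linarith)] at h2
    rw [Real.rpow_one] at hu0
    rw [Real.exp_neg u]
    set r := Real.exp u with hrdef
    have hr0 : 0 < r := Real.exp_pos u
    have h3 : Real.exp (-(c * r ^ s)) ≤ r⁻¹ := by
      rw [← mul_le_mul_iff_right₀ hr0, mul_inv_cancel₀ hr0.ne']
      exact hu0
    calc _ ≤ (r⁻¹ + C * (2 * lam / r)) / (r / 2) * r := by
            gcongr
            linarith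
      _ = _ := by field_simp

lemma auxH_real (s lam : ℝ) (hlam : 0 < lam) (u : ℝ) (h : u ≠ Real.log lam) :
    (auxH s lam (u + (0:ℝ) * Complex.I)).im = 0 := by
  have h0 : (u + (0:ℝ) * Complex.I : ℂ) = (u : ℂ) := by simp
  have hS : (u : ℂ) ∈ auxS := by simp [auxS, Real.pi_pos]
  rw [h0, auxH_eq s lam hlam _ hS (by exact_mod_cast h)]
  unfold auxN
  have : ∃ t : ℝ, (Complex.exp (-Complex.exp (s * (u:ℂ))) -
    (Real.exp (-(lam ^ s)) : ℂ) * (2 * lam / (lam + Complex.exp (u:ℂ)))) / (lam - Complex.exp (u:ℂ))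
      * Complex.exp (u:ℂ) = (t : ℂ) := by
    refine ⟨(Real.exp (-Real.exp (s * u)) -
    (Real.exp (-(lam ^ s))) * (2 * lam / (lam + Real.exp u))) / (lam - Real.exp u)
      * Real.exp u, ?_⟩
    push_cast
    rfl
  obtain ⟨t, ht⟩ := this
  rw [ht, Complex.ofReal_im]

lemma aux_arctan (lam : ℝ) (hlam : 0 < lam) :
    IntegrableOn (fun r : ℝ => 2 * lam / (lam ^ 2 + r ^ 2)) (Ioi 0) ∧
    ∫ r in Ioi (0:ℝ), 2 * lam / (lam ^ 2 + r ^ 2) = Real.pi := by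
  have e : ∀ r : ℝ, 2 * lam / (lam ^ 2 + r ^ 2) = (2 / lam) * (1 + (lam⁻¹ * r) ^ 2)⁻¹ := by
    intro r
    have : 0 < lam ^ 2 + r ^ 2 := by positivity
    field_simp
  simp_rw [e]
  constructor
  · exact ((integrable_inv_one_add_sq.comp_mul_left' (inv_ne_zero hlam.ne')).const_mul _).integrableOn
  · rw [integral_const_mul, integral_comp_mul_left_Ioi (fun x => (1 + x ^ 2)⁻¹) 0 (inv_pos.2 hlam)]
    simp
    field_simp

lemma aux_im_integral (F : ℝ → ℂ) (a : ℝ) (hF : Integrable F) (h : ∀ u, u ≠ a → (F u).im = 0) :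
    (∫ u, F u).im = 0 := by
  have h1 : ∫ u, (F u).im = (∫ u, F u).im := integral_im hF
  rw [← h1]
  apply integral_eq_zero_of_ae
  have : ∀ᵐ u : ℝ, u ≠ a := by simp [ae_iff]
  filter_upwards [this] with u hu
  simpa using h u hu

noncomputable def auxE (s r : ℝ) : ℂ :=
  Complex.exp (-Complex.exp (s * (Real.log r + (Real.pi / 2 : ℝ) * Complex.I)))

lemma auxE_meas (s : ℝ) : Measurable (auxE s) := by
  unfold auxE
  fun_prop

lemma auxE_int (s : ℝ) (hs0 : 0 < s) (hs1 : s < 1) : IntegrableOn (auxE s) (Ioi 0) := by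
  have hpi := Real.pi_pos
  have hc : 0 < Real.cos (s * (Real.pi / 2)) := by
    have h := aux_cos_pos s (Real.pi / 2) hs0 hs1 (by positivity) (aux_half s hs0 hs1).le
    exact h.1.trans_le h.2
  have h := integrableOn_rpow_mul_exp_neg_mul_rpow (s := 0) (by norm_num) hs0 hc
  refine Integrable.mono' h (auxE_meas s).aestronglyMeasurable ?_
  filter_upwards [ae_restrict_mem measurableSet_Ioi] with r hr
  unfold auxE
  rw [aux_norm_E, Real.exp_log hr, Real.rpow_zero, one_mul]
  apply le_of_eq
  congr 1
  ring

lemma aux_den (lam r : ℝ) (hlam : 0 < lam) : (lam : ℂ) - Complex.I * r ≠ 0 := by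
  intro h
  have := congrArg Complex.re h
  simp at this
  exact hlam.ne' this

lemma aux_den_norm (lam r : ℝ) (hlam : 0 < lam) : lam ≤ ‖(lam : ℂ) - Complex.I * r‖ := by
  have := Complex.abs_re_le_norm ((lam : ℂ) - Complex.I * r)
  simp [abs_of_pos hlam] at this
  exact this

lemma aux_K (s lam : ℝ) (hs0 : 0 < s) (hs1 : s < 1) (hlam : 0 < lam) :
    (∫ r in Ioi (0:ℝ), auxE s r / (lam - Complex.I * r)).re =
      Real.pi * Real.exp (-(lam ^ s)) := by
  have hpi := Real.pi_pos
  obtain ⟨hint, hst⟩ := auxH_strip s lam hs0 hs1 hlam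
  have him := aux_im_integral _ _ (hint 0 ⟨le_rfl, by positivity⟩) (auxH_real s lam hlam)
  rw [hst] at him
  obtain ⟨ai, av⟩ := aux_arctan lam hlam
  have hEi : IntegrableOn (fun r : ℝ => auxE s r / (lam - Complex.I * r)) (Ioi 0) := by
    refine Integrable.mono' ((auxE_int s hs0 hs1).norm.div_const lam) ?_ ?_
    · exact ((auxE_meas s).div (by fun_prop)).aestronglyMeasurable
    · filter_upwards with r
      rw [norm_div]
      have := aux_den_norm lam r hlam
      gcongr
  have e : ∀ u : ℝ, auxH s lam (u + (Real.pi / 2 : ℝ) * Complex.I) = 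
      (Real.exp u : ℂ) * (fun r : ℝ => Complex.I * (auxE s r / (lam - Complex.I * r) -
        (Real.exp (-(lam ^ s)) : ℂ) * ((2 * lam / (lam ^ 2 + r ^ 2) : ℝ) : ℂ))) (Real.exp u) := by
    intro u
    rw [auxH_eq s lam hlam _ (auxS_of _ u ⟨by positivity, le_rfl⟩)]
    · unfold auxN auxE
      simp only
      rw [Real.log_exp, Complex.exp_add (u:ℂ)]
      have : Complex.exp ((Real.pi / 2 : ℝ) * Complex.I) = Complex.I := by
        push_cast
        exact Complex.exp_pi_div_two_mul_I
      rw [this, ← Complex.ofReal_exp]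
      set r := Real.exp u
      have h1 := aux_den lam r hlam
      have h2 : (lam : ℂ) + r * Complex.I ≠ 0 := by
        have := aux_den lam (-r) hlam
        push_cast at this
        intro h
        apply this
        linear_combination h
      have h3 : (2 * lam / (lam + r * Complex.I) / (lam - r * Complex.I) : ℂ) =
          ((2 * lam / (lam ^ 2 + r ^ 2) : ℝ) : ℂ) := by
        push_cast
        rw [div_div]
        congr 1
        linear_combination (-(r:ℂ)^2) * Complex.I_mul_I
      rw [← h3, mul_comm Complex.I (r : ℂ)]
      ring
    · intro h
      have := congrArg Complex.im h
      simp at this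
  rw [integral_congr_ae (ae_of_all _ e)] at him
  rw [← aux_cov (fun r : ℝ => Complex.I * (auxE s r / (lam - Complex.I * r) -
        (Real.exp (-(lam ^ s)) : ℂ) * ((2 * lam / (lam ^ 2 + r ^ 2) : ℝ) : ℂ)))] at him
  have ai' : IntegrableOn (fun r : ℝ => ((2 * lam / (lam ^ 2 + r ^ 2) : ℝ) : ℂ)) (Ioi 0) :=
    ai.ofReal
  rw [ integral_const_mul, integral_sub hEi (ai'.const_mul _), integral_const_mul,
    integral_complex_ofReal, av] at him
  rw [Complex.I_mul_im, Complex.sub_re, ← Complex.ofReal_mul, Complex.ofReal_re] at him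
  linarith

/-- For `s ∈ (0,1)` and every `λ > 0`, `∫_0^∞ Φ_s(x) e^{-λx} dx = e^{-λ^s}`:
`Φ_s` is the subordination density whose Laplace transform is `e^{-λ^s}`. -/
theorem stmt_19 (s : ℝ) (hs0 : 0 < s) (hs1 : s < 1) (lam : ℝ) (hlam : 0 < lam) :
    (∫ x in Set.Ioi (0 : ℝ), subordinationDensity s x * Real.exp (-(lam * x)))
      = Real.exp (-(lam ^ s)) := by
  have hpi := Real.pi_pos
  have hexp : IntegrableOn (fun x : ℝ => Complex.exp ((-lam : ℂ) * x)) (Ioi 0) :=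
    integrableOn_exp_mul_complex_Ioi (by simpa using hlam) 0
  have hprod : Integrable (Function.uncurry fun x r : ℝ =>
      Complex.exp ((-lam : ℂ) * x) * (Complex.exp (Complex.I * x * r) * auxE s r))
      ((volume.restrict (Ioi 0)).prod (volume.restrict (Ioi 0))) := by
    have h := Integrable.mul_prod hexp (auxE_int s hs0 hs1)
    refine h.mono ?_ ?_
    · have := auxE_meas s
      apply Measurable.aestronglyMeasurable
      unfold Function.uncurry
      fun_prop
    · filter_upwards with z
      simp only [Function.uncurry, norm_mul]
      have : ‖Complex.exp (Complex.I * z.1 * z.2)‖ = 1 := by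
        rw [Complex.norm_exp]; simp
      rw [this, one_mul]
  have hD : ∀ x ∈ Ioi (0:ℝ), subordinationDensity s x * Real.exp (-(lam * x)) =
      Real.pi⁻¹ * (∫ r in Ioi (0:ℝ), 
        Complex.exp ((-lam : ℂ) * x) * (Complex.exp (Complex.I * x * r) * auxE s r)).re := by
    intro x hx
    unfold subordinationDensity
    rw [aux_density s x hs0 hs1 hx, integral_const_mul]
    change (Complex.I / Real.pi * (-Complex.I * ∫ r in Ioi (0:ℝ),
      Complex.exp (Complex.I * x * r) * auxE s r)).re * _ = _
    set J := ∫ r in Ioi (0:ℝ), Complex.exp (Complex.I * x * r) * auxE s r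
    have h1 : Complex.I / Real.pi * (-Complex.I * J) = ((Real.pi⁻¹ : ℝ) : ℂ) * J := by
      push_cast
      linear_combination (-(J / Real.pi)) * Complex.I_mul_I
    have h2 : Complex.exp ((-lam : ℂ) * x) = ((Real.exp (-(lam * x)) : ℝ) : ℂ) := by
      push_cast
      ring_nf
    rw [h1, h2, Complex.re_ofReal_mul, Complex.re_ofReal_mul]
    ring
  rw [setIntegral_congr_fun measurableSet_Ioi hD, integral_const_mul]
  have hre : ∫ x in Ioi (0:ℝ), (∫ r in Ioi (0:ℝ), 
        Complex.exp ((-lam : ℂ) * x) * (Complex.exp (Complex.I * x * r) * auxE s r)).re = 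
      (∫ x in Ioi (0:ℝ), ∫ r in Ioi (0:ℝ), 
        Complex.exp ((-lam : ℂ) * x) * (Complex.exp (Complex.I * x * r) * auxE s r)).re :=
    integral_re hprod.integral_prod_left
  rw [hre, integral_integral_swap hprod]
  have hin : ∀ r : ℝ, ∫ x in Ioi (0:ℝ), 
        Complex.exp ((-lam : ℂ) * x) * (Complex.exp (Complex.I * x * r) * auxE s r) =
      auxE s r / (lam - Complex.I * r) := by
    intro r
    have h1 : ∀ x : ℝ, Complex.exp ((-lam : ℂ) * x) * (Complex.exp (Complex.I * x * r) * auxE s r)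
        = Complex.exp ((-(lam - Complex.I * r)) * x) * auxE s r := by
      intro x
      rw [← mul_assoc, ← Complex.exp_add]
      ring_nf
    simp_rw [h1]
    rw [integral_mul_const, integral_exp_mul_complex_Ioi (by simpa using hlam)]
    rw [Complex.ofReal_zero, mul_zero, Complex.exp_zero, neg_div_neg_eq]
    ring
  simp_rw [hin]
  rw [aux_K s lam hs0 hs1 hlam]
  field_simp
end
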